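/- Let 𝒞 = {(x₁,x₂,x₃) ∈ ℝ³ : x₂² + x₃² ≤ 1} be the infinite cylinder. Let p : ℝ³ → [1,∞) be a measurable exponent such that 3 < ess inf_{ℝ³∖𝒞} p ≤ ess sup_{ℝ³∖𝒞} p < 9/2 and 9/2 < ess inf_𝒞 p ≤ ess sup_𝒞 p < ∞. If (u, P) is a weak solution of the stationary Navier–Stokes equations on ℝ³ with u ∈ L^{p(·)}(ℝ³) and P ∈ L^{p(·)/2}(ℝ³), then u = 0 almost everywhere. -/

import Mathlib

open MeasureTheory Filter Metric
open scoped ENNReal Topology NNReal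

noncomputable section

/-- `ℝ³` as a Euclidean space (coordinates `x 0, x 1, x 2` standing for `x₁, x₂, x₃`). -/
abbrev E3 : Type := EuclideanSpace ℝ (Fin 3)

/-- Partial derivative `∂ᵢ g` of a scalar function on `ℝ³`. -/
def pd (i : Fin 3) (g : E3 → ℝ) (x : E3) : ℝ :=
  fderiv ℝ g x (EuclideanSpace.single i 1)

/-- Laplacian of a scalar function on `ℝ³`. -/
def lap3 (g : E3 → ℝ) (x : E3) : ℝ := ∑ i : Fin 3, pd i (pd i g) x

/-- The modular `ρ_{p(·)}(f) = ∫ |f|^{p(x)} dx` for a finite real-valued variable exponent. -/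
def modularV (p : E3 → ℝ) (f : E3 → ℝ) : ℝ≥0∞ :=
  ∫⁻ x, ENNReal.ofReal (|f x| ^ p x)

/-- Membership in the variable exponent Lebesgue space `L^{p(·)}(ℝ³)`
(finiteness of the Luxemburg norm). -/
def MemVarLp (p : E3 → ℝ) (f : E3 → ℝ) : Prop :=
  ∃ l : ℝ, 0 < l ∧ modularV p (fun x => f x / l) ≤ 1

/-- The Luxemburg norm `‖f‖_{L^{p(·)}(ℝ³)}`. -/
def varLpNorm (p : E3 → ℝ) (f : E3 → ℝ) : ℝ :=
  sInf {l : ℝ | 0 < l ∧ modularV p (fun x => f x / l) ≤ 1}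

/-- `(u, P)` is a weak solution of the stationary Navier–Stokes equations
`Δu − (u·∇)u − ∇P = 0`, `div u = 0` on `ℝ³`. -/
def IsWeakSolutionNS (u : E3 → E3) (P : E3 → ℝ) : Prop :=
  (∀ φ : E3 → E3, ContDiff ℝ (⊤ : ℕ∞) φ → HasCompactSupport φ →
      ((∫ x, ∑ j : Fin 3, u x j * lap3 (fun y => φ y j) x) +
        (∑ i : Fin 3, ∑ j : Fin 3, ∫ x, u x i * u x j * pd i (fun y => φ y j) x) +
        (∫ x, P x * ∑ j : Fin 3, pd j (fun y => φ y j) x) = 0)) ∧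
  (∀ ψ : E3 → ℝ, ContDiff ℝ (⊤ : ℕ∞) ψ → HasCompactSupport ψ →
      (∫ x, ∑ j : Fin 3, u x j * pd j ψ x) = 0)

/-- The infinite cylinder `𝒞 = {x ∈ ℝ³ : x₂² + x₃² ≤ 1}`. -/
def cylC : Set E3 := {x | (x 1) ^ 2 + (x 2) ^ 2 ≤ 1}



/-! ### Calculus of partial derivatives -/

abbrev Smooth3 (g : E3 → ℝ) : Prop := ContDiff ℝ (⊤ : ℕ∞) g

lemma Smooth3.diff {g : E3 → ℝ} (hg : Smooth3 g) : Differentiable ℝ g :=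
  ContDiff.differentiable hg (by simp)

lemma Smooth3.pd {g : E3 → ℝ} (hg : Smooth3 g) (i : Fin 3) : Smooth3 (pd i g) := by
  unfold Smooth3 _root_.pd
  exact (hg.fderiv_right (m := (⊤ : ℕ∞)) (by simp)).clm_apply contDiff_const

lemma Smooth3.sum {ι : Type*} {s : Finset ι} {g : ι → E3 → ℝ} (hg : ∀ i, Smooth3 (g i)) :
    Smooth3 (fun x => ∑ i ∈ s, g i x) := ContDiff.sum fun i _ => hg i

lemma Smooth3.lap {g : E3 → ℝ} (hg : Smooth3 g) : Smooth3 (lap3 g) := by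
  unfold lap3
  exact Smooth3.sum fun i => (hg.pd i).pd i

lemma pd_add {f g : E3 → ℝ} (hf : Smooth3 f) (hg : Smooth3 g) (i : Fin 3) (x : E3) :
    pd i (fun y => f y + g y) x = pd i f x + pd i g x := by
  unfold pd
  rw [fderiv_fun_add (hf.diff x) (hg.diff x)]; rfl

lemma pd_sub {f g : E3 → ℝ} (hf : Smooth3 f) (hg : Smooth3 g) (i : Fin 3) (x : E3) :
    pd i (fun y => f y - g y) x = pd i f x - pd i g x := by
  unfold pd
  rw [fderiv_fun_sub (hf.diff x) (hg.diff x)]; rfl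

lemma pd_mul {f g : E3 → ℝ} (hf : Smooth3 f) (hg : Smooth3 g) (i : Fin 3) (x : E3) :
    pd i (fun y => f y * g y) x = pd i f x * g x + f x * pd i g x := by
  unfold pd
  rw [fderiv_fun_mul (hf.diff x) (hg.diff x)]
  simp; ring

lemma pd_const_mul {f : E3 → ℝ} (hf : Smooth3 f) (c : ℝ) (i : Fin 3) (x : E3) :
    pd i (fun y => c * f y) x = c * pd i f x := by
  unfold pd
  rw [fderiv_const_mul (hf.diff x)]; rfl

lemma pd_sum {ι : Type*} {s : Finset ι} {g : ι → E3 → ℝ} (hg : ∀ i, Smooth3 (g i))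
    (i : Fin 3) (x : E3) :
    pd i (fun y => ∑ k ∈ s, g k y) x = ∑ k ∈ s, pd i (g k) x := by
  unfold pd
  rw [fderiv_fun_sum (fun k _ => (hg k).diff x)]
  simp

lemma pd_zero (i : Fin 3) (x : E3) : pd i (fun _ => (0 : ℝ)) x = 0 := by
  simp [pd]

lemma pd_comm {g : E3 → ℝ} (hg : Smooth3 g) (i j : Fin 3) :
    pd i (pd j g) = pd j (pd i g) := by
  funext x
  have hs : IsSymmSndFDerivAt ℝ g x :=
    (hg.contDiffAt (x := x)).isSymmSndFDerivAt (by simp only [minSmoothness_of_isRCLikeNormedField]; exact WithTop.coe_le_coe.2 (le_top : (2:ℕ∞) ≤ ⊤))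
  have hd : Differentiable ℝ (fderiv ℝ g) :=
    (hg.fderiv_right (m := (⊤ : ℕ∞)) (by simp)).differentiable (by simp)
  have key : ∀ a b : Fin 3, pd a (pd b g) x =
      fderiv ℝ (fderiv ℝ g) x (EuclideanSpace.single a 1) (EuclideanSpace.single b 1) := by
    intro a b
    unfold pd
    rw [fderiv_clm_apply (hd x) (differentiableAt_const _)]
    simp
  rw [key, key]
  exact hs _ _

lemma pd_congr_nhds {f g : E3 → ℝ} {x : E3} (h : f =ᶠ[𝓝 x] g) (i : Fin 3) :
    pd i f x = pd i g x := by
  unfold pd; rw [h.fderiv_eq]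

lemma pd_tsupport (g : E3 → ℝ) (i : Fin 3) : tsupport (pd i g) ⊆ tsupport g := by
  refine closure_minimal ?_ isClosed_closure
  intro x hx
  by_contra hn
  apply hx
  have : g =ᶠ[𝓝 x] fun _ => 0 := notMem_tsupport_iff_eventuallyEq.1 hn
  rw [pd_congr_nhds this, pd_zero]

lemma HasCompactSupport.pd' {g : E3 → ℝ} (hg : HasCompactSupport g) (i : Fin 3) :
    HasCompactSupport (pd i g) :=
  hg.of_isClosed_subset isClosed_closure (pd_tsupport g i)

lemma Smooth3.integrable {g : E3 → ℝ} (hg : Smooth3 g) (hc : HasCompactSupport g) :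
    Integrable g := hg.continuous.integrable_of_hasCompactSupport hc

lemma integral_pd_eq_zero {g : E3 → ℝ} (hg : Smooth3 g) (hc : HasCompactSupport g)
    (i : Fin 3) : ∫ x, pd i g x = 0 := by
  have := integral_mul_fderiv_eq_neg_fderiv_mul_of_integrable (μ := (volume : Measure E3))
    (f := fun _ : E3 => (1 : ℝ)) (g := g) (v := EuclideanSpace.single i 1)
    (by simp) (by simp only [one_mul]; exact (hg.pd i).integrable (hc.pd' i))
    (by simpa using hg.integrable hc) (by intro x _; fun_prop) (by intro x _; exact hg.diff x)
  simpa [pd] using this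

lemma pd_scale {g : E3 → ℝ} (hg : Smooth3 g) (c : ℝ) (i : Fin 3) (x : E3) :
    pd i (fun y => g (c • y)) x = c * pd i g (c • x) := by
  unfold pd
  have h1 : HasFDerivAt (fun y : E3 => c • y) (c • ContinuousLinearMap.id ℝ E3) x :=
    (hasFDerivAt_id x).const_smul c
  have h2 := ((hg.diff (c • x)).hasFDerivAt).comp x h1
  have h3 : fderiv ℝ (fun y => g (c • y)) x = _ := h2.fderiv
  rw [h3]; simp

/-- derivative in `y` of `κ (x - y)` -/
lemma pd_reflect {g : E3 → ℝ} (hg : Smooth3 g) (a : E3) (i : Fin 3) (y : E3) :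
    pd i (fun z => g (a - z)) y = - pd i g (a - y) := by
  unfold pd
  have h1 : HasFDerivAt (fun z : E3 => a - z) (-ContinuousLinearMap.id ℝ E3) y := by
    simpa using (hasFDerivAt_id y).const_sub a
  have h2 := ((hg.diff (a - y)).hasFDerivAt).comp y h1
  have h3 : fderiv ℝ (fun z => g (a - z)) y = _ := h2.fderiv
  rw [h3]; simp

/-- radial functions -/
lemma pd_radial {h : ℝ → ℝ} {h1 : ℝ} {a y : E3} (hh : HasDerivAt h h1 (‖y - a‖ ^ 2))
    (i : Fin 3) : pd i (fun z => h (‖z - a‖ ^ 2)) y = 2 * (y i - a i) * h1 := by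
  unfold pd
  have e1 : HasFDerivAt (fun z : E3 => ‖z - a‖ ^ 2) (2 • (innerSL ℝ (y - a))) y := by
    have := ((hasFDerivAt_id y).sub_const a).norm_sq
    simpa using this
  have h2 := hh.comp_hasFDerivAt y e1
  have h3 : fderiv ℝ (fun z => h (‖z - a‖ ^ 2)) y = _ := h2.fderiv
  rw [h3]
  simp [EuclideanSpace.inner_single_right]
  ring

lemma pd_coord (i j : Fin 3) (c : ℝ) (y : E3) :
    pd i (fun z : E3 => z j - c) y = if i = j then 1 else 0 := by
  unfold pd
  have : HasFDerivAt (fun z : E3 => z j - c) (EuclideanSpace.proj (𝕜 := ℝ) j : E3 →L[ℝ] ℝ) y := by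
    have := (EuclideanSpace.proj (𝕜 := ℝ) j : E3 →L[ℝ] ℝ).hasFDerivAt (x := y)
    exact this.sub_const c
  rw [this.fderiv]
  simp [eq_comm]


/-! ### Regularised biharmonic kernel -/

lemma pd_mul' {f g : E3 → ℝ} {x : E3} (hf : DifferentiableAt ℝ f x) (hg : DifferentiableAt ℝ g x)
    (i : Fin 3) :
    pd i (fun y => f y * g y) x = pd i f x * g x + f x * pd i g x := by
  unfold pd
  rw [fderiv_fun_mul hf hg]
  simp; ring

lemma radial_diff {h : ℝ → ℝ} {h1 : ℝ} {a y : E3} (hh : HasDerivAt h h1 (‖y - a‖ ^ 2)) :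
    DifferentiableAt ℝ (fun z => h (‖z - a‖ ^ 2)) y := by
  have e1 : DifferentiableAt ℝ (fun z : E3 => ‖z - a‖ ^ 2) y :=
    (differentiableAt_id.sub_const a).norm_sq ℝ
  exact hh.differentiableAt.comp y e1

lemma coord_diff (j : Fin 3) (c : ℝ) (y : E3) : DifferentiableAt ℝ (fun z : E3 => z j - c) y := by
  have := (EuclideanSpace.proj (𝕜 := ℝ) j : E3 →L[ℝ] ℝ).differentiableAt (x := y)
  exact this.sub_const c

lemma pd_lin_radial {h : ℝ → ℝ} {h1 : ℝ} {a y : E3} (hh : HasDerivAt h h1 (‖y - a‖ ^ 2))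
    (i j : Fin 3) : pd i (fun z => (z j - a j) * h (‖z - a‖ ^ 2)) y =
      (if i = j then 1 else 0) * h (‖y - a‖ ^ 2) + 2 * (y i - a i) * (y j - a j) * h1 := by
  rw [pd_mul' (coord_diff j _ y) (radial_diff hh), pd_coord, pd_radial hh]
  ring

lemma pd_bil_radial {h : ℝ → ℝ} {h1 : ℝ} {a y : E3} (hh : HasDerivAt h h1 (‖y - a‖ ^ 2))
    (i j k : Fin 3) : pd i (fun z => (z j - a j) * ((z k - a k) * h (‖z - a‖ ^ 2))) y =
      (if i = j then 1 else 0) * ((y k - a k) * h (‖y - a‖ ^ 2)) +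
      (y j - a j) * ((if i = k then 1 else 0) * h (‖y - a‖ ^ 2)
        + 2 * (y i - a i) * (y k - a k) * h1) := by
  rw [pd_mul' (coord_diff j _ y) ((coord_diff k _ y).fun_mul (radial_diff hh)), pd_coord,
    pd_lin_radial hh]

lemma pd_const_mul' {f : E3 → ℝ} (c : ℝ) (i : Fin 3) (x : E3) :
    pd i (fun y => c * f y) x = c * pd i f x := by
  unfold pd
  have : fderiv ℝ (fun y => c * f y) x = c • fderiv ℝ f x := by
    exact congrFun (fderiv_const_smul_field (𝕜 := ℝ) (f := f) c) x
  rw [this]; rfl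

lemma pd_add' {f g : E3 → ℝ} {x : E3} (hf : DifferentiableAt ℝ f x) (hg : DifferentiableAt ℝ g x)
    (i : Fin 3) :
    pd i (fun y => f y + g y) x = pd i f x + pd i g x := by
  unfold pd
  rw [fderiv_fun_add hf hg]; rfl

lemma sum_sq_sub (y a : E3) : ∑ i : Fin 3, (y i - a i) ^ 2 = ‖y - a‖ ^ 2 := by
  rw [EuclideanSpace.norm_sq_eq]; simp

lemma pd2_radial {h h1 h2 : ℝ → ℝ} {a : E3}
    (H0 : ∀ t, 0 ≤ t → HasDerivAt h (h1 t) t) (H1 : ∀ t, 0 ≤ t → HasDerivAt h1 (h2 t) t)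
    (i j : Fin 3) (y : E3) : pd i (pd j (fun z => h (‖z - a‖ ^ 2))) y =
      2 * ((if i = j then 1 else 0) * h1 (‖y - a‖ ^ 2)) +
        4 * ((y i - a i) * ((y j - a j) * h2 (‖y - a‖ ^ 2))) := by
  have e : pd j (fun z => h (‖z - a‖ ^ 2)) = fun z => 2 * ((z j - a j) * h1 (‖z - a‖ ^ 2)) := by
    funext z
    rw [pd_radial (H0 _ (by positivity))]; ring
  rw [e, pd_const_mul', pd_lin_radial (H1 _ (by positivity))]
  ring

lemma lap_radial {h h1 h2 : ℝ → ℝ} {a : E3}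
    (H0 : ∀ t, 0 ≤ t → HasDerivAt h (h1 t) t) (H1 : ∀ t, 0 ≤ t → HasDerivAt h1 (h2 t) t) :
    lap3 (fun z => h (‖z - a‖ ^ 2)) =
      fun y => 6 * h1 (‖y - a‖ ^ 2) + 4 * ‖y - a‖ ^ 2 * h2 (‖y - a‖ ^ 2) := by
  funext y
  unfold lap3
  simp_rw [pd2_radial H0 H1]
  rw [← sum_sq_sub y a]
  simp only [Fin.sum_univ_three]
  simp
  ring

lemma pd3_radial {h h1 h2 h3 : ℝ → ℝ} {a : E3}
    (H0 : ∀ t, 0 ≤ t → HasDerivAt h (h1 t) t) (H1 : ∀ t, 0 ≤ t → HasDerivAt h1 (h2 t) t)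
    (H2 : ∀ t, 0 ≤ t → HasDerivAt h2 (h3 t) t)
    (i j k : Fin 3) (y : E3) : pd i (pd j (pd k (fun z => h (‖z - a‖ ^ 2)))) y =
      4 * ((if j = k then 1 else 0) * (y i - a i) + (if i = j then 1 else 0) * (y k - a k)
        + (if i = k then 1 else 0) * (y j - a j)) * h2 (‖y - a‖ ^ 2) +
      8 * (y i - a i) * (y j - a j) * (y k - a k) * h3 (‖y - a‖ ^ 2) := by
  have e : pd j (pd k (fun z => h (‖z - a‖ ^ 2))) = fun y =>
      (2 * (if j = k then 1 else 0)) * h1 (‖y - a‖ ^ 2) +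
        4 * ((y j - a j) * ((y k - a k) * h2 (‖y - a‖ ^ 2))) := by
    funext z
    rw [pd2_radial H0 H1]; ring
  have P := H2 (‖y - a‖ ^ 2) (by positivity)
  have P1 := H1 (‖y - a‖ ^ 2) (by positivity)
  rw [e, pd_add' ((radial_diff P1).const_mul _) (DifferentiableAt.const_mul
    ((coord_diff j _ y).fun_mul ((coord_diff k _ y).fun_mul (radial_diff P))) _),
    pd_const_mul', pd_const_mul', pd_bil_radial P, pd_radial P1]
  ring

/-- cut-off in the variable `t = |z|^2` -/
def th (n : ℕ) : ℝ → ℝ := iteratedDeriv n (fun t => Real.smoothTransition (3 - t))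

lemma th_smooth : ContDiff ℝ (⊤ : ℕ∞) (fun t => Real.smoothTransition (3 - t)) :=
  Real.smoothTransition.contDiff.comp (contDiff_const.sub contDiff_id)

lemma th_hasDeriv (n : ℕ) (t : ℝ) : HasDerivAt (th n) (th (n + 1) t) t := by
  unfold th
  rw [iteratedDeriv_succ]
  exact (th_smooth.differentiable_iteratedDeriv n
    (WithTop.coe_lt_coe.2 (ENat.natCast_lt_top n)) t).hasDerivAt

lemma th_cont (n : ℕ) : Continuous (th n) :=
  continuous_iff_continuousAt.2 fun t => (th_hasDeriv n t).continuousAt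

lemma th_zero_eq (t : ℝ) : th 0 t = Real.smoothTransition (3 - t) := by simp [th]

lemma th_one {t : ℝ} (ht : t < 2) : th 0 t = 1 := by
  rw [th_zero_eq]; exact Real.smoothTransition.one_of_one_le (by linarith)

lemma th_far {t : ℝ} (ht : 3 < t) (n : ℕ) : th n t = 0 := by
  induction n generalizing t with
  | zero => rw [th_zero_eq]; exact Real.smoothTransition.zero_of_nonpos (by linarith)
  | succ n ih =>
    have h1 := (th_hasDeriv n t)
    have : th n =ᶠ[𝓝 t] fun _ => 0 := by
      filter_upwards [Ioi_mem_nhds ht] with s hs using ih hs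
    exact h1.unique ((hasDerivAt_const t (0:ℝ)).congr_of_eventuallyEq this)

lemma th_near {t : ℝ} (ht : t < 2) (n : ℕ) : th (n + 1) t = 0 := by
  induction n generalizing t with
  | zero =>
    have h1 := (th_hasDeriv 0 t)
    have : th 0 =ᶠ[𝓝 t] fun _ => 1 := by
      filter_upwards [Iio_mem_nhds ht] with s hs using th_one hs
    exact h1.unique ((hasDerivAt_const t (1:ℝ)).congr_of_eventuallyEq this)
  | succ n ih =>
    have h1 := (th_hasDeriv (n+1) t)
    have : th (n+1) =ᶠ[𝓝 t] fun _ => 0 := by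
      filter_upwards [Iio_mem_nhds ht] with s hs using ih hs
    exact h1.unique ((hasDerivAt_const t (0:ℝ)).congr_of_eventuallyEq this)

lemma th_bound : ∃ M : ℝ, 0 ≤ M ∧ ∀ n ≤ 4, ∀ t, 0 ≤ t → |th n t| ≤ M := by
  have : ∀ n, ∃ M : ℝ, 0 ≤ M ∧ ∀ t, 0 ≤ t → |th n t| ≤ M := by
    intro n
    obtain ⟨M, hM⟩ := (isCompact_Icc (a := (0:ℝ)) (b := 4)).exists_bound_of_continuousOn
      (th_cont n).continuousOn
    refine ⟨max M 0, le_max_right _ _, fun t ht => ?_⟩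
    by_cases h : t ≤ 4
    · exact (hM t ⟨ht, h⟩).trans (le_max_left _ _)
    · rw [th_far (by linarith)]; simp
  choose M hM0 hM using this
  refine ⟨∑ k ∈ Finset.range 5, M k, Finset.sum_nonneg fun k _ => hM0 k, fun n hn t ht => ?_⟩
  exact (hM n t ht).trans (Finset.single_le_sum (f := M) (fun k _ => hM0 k)
    (Finset.mem_range.2 (by omega)))

def cf : ℕ → ℝ
  | 0 => 1
  | n + 1 => cf n * (1 / 2 - n)

def sg (e : ℝ) (n : ℕ) (t : ℝ) : ℝ := cf n * (t + e) ^ ((1 : ℝ) / 2 - n)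

lemma sg_hasDeriv {e : ℝ} (n : ℕ) {t : ℝ} (h : 0 < t + e) :
    HasDerivAt (sg e n) (sg e (n + 1) t) t := by
  unfold sg
  have h1 : HasDerivAt (fun s => s + e) 1 t := (hasDerivAt_id t).add_const e
  have := (h1.rpow_const (p := (1:ℝ)/2 - n) (Or.inl h.ne')).const_mul (cf n)
  convert! this using 1
  simp only [cf]; push_cast
  rw [show (1:ℝ)/2 - (n + 1) = 1/2 - n - 1 by ring]; ring

lemma cf_bound {n : ℕ} (hn : n ≤ 4) : |cf n| ≤ 1 := by
  interval_cases n <;> norm_num [cf, abs_le]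

def hh (e : ℝ) (n : ℕ) (t : ℝ) : ℝ :=
  ∑ k ∈ Finset.range (n + 1), (n.choose k : ℝ) * (th k t * sg e (n - k) t)

lemma hh_hasDeriv {e : ℝ} {n : ℕ} (hn : n ≤ 3) {t : ℝ} (h : 0 < t + e) :
    HasDerivAt (hh e n) (hh e (n + 1) t) t := by
  have D : ∀ k m, HasDerivAt (fun s => th k s * sg e m s)
      (th (k+1) t * sg e m t + th k t * sg e (m+1) t) t :=
    fun k m => (th_hasDeriv k t).mul (sg_hasDeriv m h)
  have : HasDerivAt (hh e n) (∑ k ∈ Finset.range (n + 1), (n.choose k : ℝ) *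
      (th (k+1) t * sg e (n-k) t + th k t * sg e (n-k+1) t)) t := by
    unfold hh
    exact HasDerivAt.fun_sum fun k _ => (D k (n-k)).const_mul _
  convert! this using 1
  unfold hh
  interval_cases n <;> simp [Finset.sum_range_succ, Nat.choose] <;> ring

lemma hh_far {e : ℝ} {n : ℕ} {t : ℝ} (ht : 3 < t) : hh e n t = 0 := by
  unfold hh; simp [th_far ht]

lemma hh_near {e : ℝ} {n : ℕ} {t : ℝ} (ht : t < 2) : hh e n t = sg e n t := by
  unfold hh
  rw [Finset.sum_range_succ']
  simp [th_near ht, th_one ht]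

lemma hh_bound : ∃ C : ℝ, 0 ≤ C ∧ ∀ e t, 0 < e → e ≤ 1 → 0 ≤ t → ∀ n ≤ 4,
    |hh e n t| ≤ C * (t + e) ^ ((1 : ℝ) / 2 - n) := by
  obtain ⟨M, hM0, hM⟩ := th_bound
  refine ⟨5 * (24 * (M * 5 ^ 4)), by positivity, fun e t he he1 ht n hn => ?_⟩
  by_cases ht3 : 3 < t
  · rw [hh_far ht3]; simp only [abs_zero]; positivity
  unfold hh
  have hpos : 0 < t + e := by linarith
  calc |∑ k ∈ Finset.range (n + 1), (n.choose k : ℝ) * (th k t * sg e (n - k) t)|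
      ≤ ∑ k ∈ Finset.range (n + 1), |(n.choose k : ℝ) * (th k t * sg e (n - k) t)| :=
        Finset.abs_sum_le_sum_abs _ _
    _ ≤ ∑ k ∈ Finset.range (n + 1), 24 * (M * 5 ^ 4) * (t + e) ^ ((1 : ℝ) / 2 - n) := by
        refine Finset.sum_le_sum fun k hk => ?_
        have hk' : k ≤ n := by simp at hk; omega
        rw [abs_mul, abs_mul]
        have c1 : |(n.choose k : ℝ)| ≤ 24 := by
          rw [Nat.abs_cast]
          have : n.choose k ≤ 24 := by
            interval_cases n <;> interval_cases k <;> simp [Nat.choose]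
          exact_mod_cast this
        have c2 := hM k (by omega) t ht
        have c3 : |sg e (n - k) t| ≤ 5 ^ 4 * (t + e) ^ ((1 : ℝ) / 2 - n) := by
          unfold sg
          rw [abs_mul]
          have q1 : (t + e) ^ ((1 : ℝ) / 2 - (n - k : ℕ)) =
              (t + e) ^ k * (t + e) ^ ((1 : ℝ) / 2 - n) := by
            rw [← Real.rpow_natCast, ← Real.rpow_add hpos]
            congr 1; rw [Nat.cast_sub hk']; ring
          have q2 : (t + e) ^ k ≤ 5 ^ 4 := by
            calc (t + e) ^ k ≤ 5 ^ k := pow_le_pow_left₀ hpos.le (by linarith) k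
              _ ≤ 5 ^ 4 := pow_le_pow_right₀ (by norm_num) (by omega)
          have q3 : 0 ≤ (t + e) ^ ((1 : ℝ) / 2 - n) := by positivity
          rw [q1, abs_of_nonneg (mul_nonneg (by positivity) q3)]
          calc _ ≤ 1 * ((t + e) ^ k * (t + e) ^ ((1 : ℝ) / 2 - n)) := by
                gcongr; exact cf_bound (by omega)
            _ ≤ _ := by rw [one_mul]; gcongr
        calc |(n.choose k : ℝ)| * (|th k t| * |sg e (n - k) t|)
            ≤ 24 * (M * (5 ^ 4 * (t + e) ^ ((1 : ℝ) / 2 - n))) := by gcongr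
          _ = _ := by ring
    _ ≤ _ := by
        rw [Finset.sum_const, nsmul_eq_mul, Finset.card_range]
        have : ((n + 1 : ℕ) : ℝ) ≤ 5 := by exact_mod_cast (by omega : n + 1 ≤ 5)
        have q3 : 0 ≤ (t + e) ^ ((1 : ℝ) / 2 - n) := by positivity
        calc _ ≤ 5 * (24 * (M * 5 ^ 4) * (t + e) ^ ((1 : ℝ) / 2 - n)) := by gcongr
          _ = _ := by ring


def QQ (e : ℝ) (a : E3) : E3 → ℝ := fun z => hh e 0 (‖z - a‖ ^ 2)

def kr (z : E3) : ℝ := if ‖z‖ < 2 then (‖z‖ ^ 2)⁻¹ else 0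

lemma kr_nonneg (z : E3) : 0 ≤ kr z := by unfold kr; split_ifs <;> positivity

lemma QQ_smooth {e : ℝ} (he : 0 < e) (a : E3) : Smooth3 (QQ e a) := by
  have : QQ e a = fun z => Real.smoothTransition (3 - ‖z - a‖ ^ 2) *
      (‖z - a‖ ^ 2 + e) ^ ((1 : ℝ) / 2) := by
    funext z; simp [QQ, hh, sg, cf, th_zero_eq]
  rw [this]
  have h1 : ContDiff ℝ (⊤ : ℕ∞) (fun z : E3 => ‖z - a‖ ^ 2) :=
    (contDiff_id.sub contDiff_const).norm_sq ℝ
  refine ContDiff.mul (th_smooth.comp h1) ?_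
  refine ContDiff.rpow_const_of_ne (h1.add contDiff_const) fun z => ?_
  positivity

lemma QQ_supp (e : ℝ) (a : E3) : HasCompactSupport (QQ e a) := by
  refine HasCompactSupport.intro (isCompact_closedBall a 2) fun x hx => ?_
  simp only [mem_closedBall, dist_eq_norm, not_le] at hx
  exact hh_far (by nlinarith)

lemma hh_der {e : ℝ} (he : 0 < e) {n : ℕ} (hn : n ≤ 3) (t : ℝ) (ht : 0 ≤ t) :
    HasDerivAt (hh e n) (hh e (n + 1) t) t := hh_hasDeriv hn (by linarith)

lemma lap2_QQ {e : ℝ} (he : 0 < e) (a y : E3) : lap3 (lap3 (QQ e a)) y =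
    60 * hh e 2 (‖y - a‖ ^ 2) + 80 * ‖y - a‖ ^ 2 * hh e 3 (‖y - a‖ ^ 2)
      + 16 * (‖y - a‖ ^ 2) ^ 2 * hh e 4 (‖y - a‖ ^ 2) := by
  have e1 : lap3 (QQ e a) = _ := lap_radial (a := a) (hh_der he (n := 0) (by omega))
    (hh_der he (n := 1) (by omega))
  have G0 : ∀ t, 0 ≤ t → HasDerivAt (fun s => 6 * hh e 1 s + 4 * s * hh e 2 s)
      (10 * hh e 2 t + 4 * t * hh e 3 t) t := by
    intro t ht
    have a1 := (hh_der he (n := 1) (by omega) t ht).const_mul 6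
    have a2 := ((hasDerivAt_id t).const_mul 4).mul (hh_der he (n := 2) (by omega) t ht)
    convert! a1.add a2 using 1
    simp; ring
  have G1 : ∀ t, 0 ≤ t → HasDerivAt (fun s => 10 * hh e 2 s + 4 * s * hh e 3 s)
      (14 * hh e 3 t + 4 * t * hh e 4 t) t := by
    intro t ht
    have a1 := (hh_der he (n := 2) (by omega) t ht).const_mul 10
    have a2 := ((hasDerivAt_id t).const_mul 4).mul (hh_der he (n := 3) (by omega) t ht)
    convert! a1.add a2 using 1
    simp; ring
  have e2 := congrFun (lap_radial (a := a) G0 G1) y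
  rw [e1]
  simp only [Nat.reduceAdd] at e2 ⊢
  rw [e2]
  ring

lemma lap2_near {e : ℝ} (he : 0 < e) {a y : E3} (h : ‖y - a‖ ^ 2 < 2) :
    lap3 (lap3 (QQ e a)) y = - (15 * e ^ 2 * (‖y - a‖ ^ 2 + e) ^ (-(7 : ℝ) / 2)) := by
  rw [lap2_QQ he, hh_near h, hh_near h, hh_near h]
  set t := ‖y - a‖ ^ 2
  have ht : 0 < t + e := by positivity
  simp only [sg, cf]
  have e2 : (t + e) ^ ((1 : ℝ) / 2 - (2:ℕ)) = (t + e) ^ 2 * (t + e) ^ (-(7 : ℝ) / 2) := by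
    rw [← Real.rpow_natCast, ← Real.rpow_add ht]; norm_num
  have e3 : (t + e) ^ ((1 : ℝ) / 2 - (3:ℕ)) = (t + e) * (t + e) ^ (-(7 : ℝ) / 2) := by
    rw [← Real.rpow_one_add' ht.le (by norm_num)]; norm_num
  have e4 : (t + e) ^ ((1 : ℝ) / 2 - (4:ℕ)) = (t + e) ^ (-(7 : ℝ) / 2) := by norm_num
  rw [e2, e3, e4]
  push_cast
  ring

lemma rpow_half_bound {r e : ℝ} (hr : 0 < r) (he : 0 < e) (n : ℕ) :
    (r ^ 2 + e) ^ ((1 : ℝ) / 2 - (n + 1 : ℕ)) ≤ (r ^ (2 * n + 1))⁻¹ := by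
  have : (r ^ 2 + e) ^ ((1 : ℝ) / 2 - (n + 1 : ℕ)) ≤ (r ^ 2) ^ ((1 : ℝ) / 2 - (n + 1 : ℕ)) :=
    Real.rpow_le_rpow_of_nonpos (by positivity) (by linarith) (by push_cast; linarith)
  refine this.trans (le_of_eq ?_)
  rw [← Real.rpow_natCast, ← Real.rpow_mul hr.le, ← Real.rpow_natCast, ← Real.rpow_neg hr.le]
  congr 1; push_cast; ring

lemma abs_coord_le (z : E3) (i : Fin 3) : |z i| ≤ ‖z‖ := by
  simpa using PiLp.norm_apply_le z i

lemma third_bound : ∃ C : ℝ, 0 ≤ C ∧ ∀ e, 0 < e → e ≤ 1 → ∀ (a y : E3),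
    (∀ i j k : Fin 3, |pd i (pd j (pd k (QQ e a))) y| ≤ C * kr (y - a)) ∧
    (2 ≤ ‖y - a‖ ^ 2 → |lap3 (lap3 (QQ e a)) y| ≤ C * kr (y - a)) := by
  obtain ⟨C, hC0, hC⟩ := hh_bound
  refine ⟨156 * C, by positivity, fun e he he1 a y => ?_⟩
  set r := ‖y - a‖ with hrdef
  have hr0 : 0 ≤ r := norm_nonneg _
  by_cases hr2 : 2 ≤ r
  · have far : ∀ n, hh e n (r ^ 2) = 0 := fun n => hh_far (by nlinarith)
    have hkr : kr (y - a) = 0 := by simp [kr, ← hrdef, not_lt.2 hr2]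
    constructor
    · intro i j k
      have := pd3_radial (a := a) (hh_der he (n := 0) (by omega)) (hh_der he (n := 1) (by omega))
        (hh_der he (n := 2) (by omega)) i j k y
      unfold QQ
      rw [this, ← hrdef]; simp only [Nat.reduceAdd, far, hkr]; simp
    · intro _
      rw [lap2_QQ he, ← hrdef]; simp only [far, hkr]; simp
  push Not at hr2
  have hkr : kr (y - a) = (r ^ 2)⁻¹ := by simp [kr, ← hrdef, hr2]
  have hc : ∀ i, |y i - a i| ≤ r := fun i => by simpa using abs_coord_le (y - a) i
  rcases hr0.eq_or_lt with h0 | hr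
  · constructor
    · intro i j k
      have := pd3_radial (a := a) (hh_der he (n := 0) (by omega)) (hh_der he (n := 1) (by omega))
        (hh_der he (n := 2) (by omega)) i j k y
      have hz : ∀ i, y i - a i = 0 := fun i => by
        have := hc i; rw [← h0] at this; simpa using this
      unfold QQ
      rw [this]; simp only [hz]; simp
      exact mul_nonneg (by positivity) (kr_nonneg _)
    · intro h; rw [← h0] at h; norm_num at h
  have b2 : |hh e 2 (r ^ 2)| ≤ C * (r ^ 3)⁻¹ :=
    (hC e (r^2) he he1 (by positivity) 2 (by omega)).trans
      (mul_le_mul_of_nonneg_left (rpow_half_bound hr he 1) hC0)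
  have b3 : |hh e 3 (r ^ 2)| ≤ C * (r ^ 5)⁻¹ :=
    (hC e (r^2) he he1 (by positivity) 3 (by omega)).trans
      (mul_le_mul_of_nonneg_left (rpow_half_bound hr he 2) hC0)
  have b4 : |hh e 4 (r ^ 2)| ≤ C * (r ^ 7)⁻¹ :=
    (hC e (r^2) he he1 (by positivity) 4 (by omega)).trans
      (mul_le_mul_of_nonneg_left (rpow_half_bound hr he 3) hC0)
  rw [hkr]
  constructor
  · intro i j k
    have := pd3_radial (a := a) (hh_der he (n := 0) (by omega)) (hh_der he (n := 1) (by omega))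
        (hh_der he (n := 2) (by omega)) i j k y
    unfold QQ
    rw [this, ← hrdef]
    have d1 : ∀ (P : Prop) [Decidable P] (x : ℝ), |x| ≤ r → |(if P then (1:ℝ) else 0) * x| ≤ r := by
      intro P _ x hx; split_ifs <;> simp [hx, hr.le]
    have s1 : |(if j = k then (1:ℝ) else 0) * (y i - a i) + (if i = j then 1 else 0) * (y k - a k)
        + (if i = k then 1 else 0) * (y j - a j)| ≤ 3 * r := by
      refine (abs_add_three _ _ _).trans ?_
      linarith [d1 (j = k) _ (hc i), d1 (i = j) _ (hc k), d1 (i = k) _ (hc j)]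
    have s2 : |8 * (y i - a i) * (y j - a j) * (y k - a k)| ≤ 8 * r * r * r := by
      rw [abs_mul, abs_mul, abs_mul, abs_of_pos (by norm_num : (0:ℝ) < 8)]
      gcongr <;> apply hc
    refine (abs_add_le _ _).trans ?_
    rw [abs_mul, abs_mul, abs_mul, abs_of_pos (by norm_num : (0:ℝ) < 4)]
    calc _ ≤ 4 * (3 * r) * (C * (r ^ 3)⁻¹) + 8 * r * r * r * (C * (r ^ 5)⁻¹) := by
          gcongr
      _ = 20 * C * (r ^ 2)⁻¹ := by field_simp; ring
      _ ≤ _ := by gcongr; norm_num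
  · intro h2
    rw [lap2_QQ he, ← hrdef]
    refine (abs_add_three _ _ _).trans ?_
    have : (r ^ 3)⁻¹ ≤ (r^2)⁻¹ := by
      have : 1 ≤ r := by nlinarith
      gcongr
      norm_num
    rw [abs_mul 60, abs_mul (80 * r ^ 2), abs_mul (16 * (r ^ 2) ^ 2), abs_of_pos (by norm_num : (0:ℝ) < 60),
      abs_of_pos (by positivity : (0:ℝ) < 80 * r ^ 2),
      abs_of_pos (by positivity : (0:ℝ) < 16 * (r ^ 2) ^ 2)]
    calc _ ≤ 60 * (C * (r ^ 3)⁻¹) + 80 * r ^ 2 * (C * (r ^ 5)⁻¹) + 16 * (r ^ 2) ^ 2 * (C * (r ^ 7)⁻¹) := by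
          gcongr
      _ = 156 * C * (r ^ 3)⁻¹ := by field_simp; ring
      _ ≤ _ := by gcongr


lemma loc_uij {u : E3 → E3} (hu_meas : Measurable u)
    (hu_loc : LocallyIntegrable (fun x => ‖u x‖ ^ 2) volume) (i j : Fin 3) :
    LocallyIntegrable (fun x => u x i * u x j) volume := by
  refine hu_loc.mono ?_ (Eventually.of_forall fun x => ?_)
  · have := hu_meas
    exact (by fun_prop : Measurable fun x => u x i * u x j).aestronglyMeasurable
  · rw [norm_mul, Real.norm_eq_abs, Real.norm_eq_abs, Real.norm_of_nonneg (by positivity), sq]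
    exact mul_le_mul (abs_coord_le _ _) (abs_coord_le _ _) (abs_nonneg _) (norm_nonneg _)

lemma loc_ui {u : E3 → E3} (hu_meas : Measurable u)
    (hu_loc : LocallyIntegrable (fun x => ‖u x‖ ^ 2) volume) (i : Fin 3) :
    LocallyIntegrable (fun x => u x i) volume := by
  have h1 : LocallyIntegrable (fun x : E3 => 1 + ‖u x‖ ^ 2) volume :=
    (locallyIntegrable_const 1).add hu_loc
  refine h1.mono ?_ (Eventually.of_forall fun x => ?_)
  · have := hu_meas
    exact (by fun_prop : Measurable fun x => u x i).aestronglyMeasurable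
  · rw [Real.norm_eq_abs, Real.norm_of_nonneg (by positivity)]
    have := abs_coord_le (u x) i
    nlinarith [sq_nonneg (‖u x‖ - 1)]

lemma loc_mul_int {f g : E3 → ℝ} (hf : LocallyIntegrable f volume) (hg : Continuous g)
    (hc : HasCompactSupport g) : Integrable (fun x => f x * g x) :=
  hf.integrable_smul_right_of_hasCompactSupport hg hc

lemma HasCompactSupport.lap' {g : E3 → ℝ} (hg : HasCompactSupport g) :
    HasCompactSupport (lap3 g) := by
  refine hg.of_isClosed_subset isClosed_closure (closure_minimal ?_ isClosed_closure)
  intro x hx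
  by_contra hn
  apply hx
  unfold lap3
  refine Finset.sum_eq_zero fun i _ => ?_
  have : x ∉ tsupport (pd i (pd i g)) := fun h => hn (pd_tsupport g i (pd_tsupport _ i h))
  exact image_eq_zero_of_notMem_tsupport this

lemma lap_pd {g : E3 → ℝ} (hg : Smooth3 g) (i : Fin 3) : lap3 (pd i g) = pd i (lap3 g) := by
  funext x
  unfold lap3
  rw [pd_sum (fun k => (hg.pd k).pd k)]
  refine Finset.sum_congr rfl fun k _ => ?_
  rw [pd_comm hg k i, pd_comm (hg.pd k) k i]

def stokesTest (Q : E3 → ℝ) (k : Fin 3) (y : E3) : E3 :=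
  WithLp.toLp 2 (fun j => (if j = k then 1 else 0) * lap3 Q y - pd j (pd k Q) y)

lemma weak_stokes {u : E3 → E3} {P : E3 → ℝ} (hu_meas : Measurable u)
    (hu_loc : LocallyIntegrable (fun x => ‖u x‖ ^ 2) volume)
    (hweak : IsWeakSolutionNS u P) {Q : E3 → ℝ} (hQ : Smooth3 Q) (hc : HasCompactSupport Q)
    (k : Fin 3) :
    ∫ y, u y k * lap3 (lap3 Q) y =
      - ∑ i : Fin 3, ∑ j : Fin 3, ∫ y, u y i * u y j *
        ((if j = k then 1 else 0) * pd i (lap3 Q) y - pd i (pd j (pd k Q)) y) := by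
  have hcomp : ∀ j, (fun y => stokesTest Q k y j) =
      fun y => (if j = k then 1 else 0) * lap3 Q y - pd j (pd k Q) y := fun j => rfl
  have s1 : ∀ j : Fin 3, Smooth3 (fun y => (if j = k then (1:ℝ) else 0) * lap3 Q y) :=
    fun j => contDiff_const.mul hQ.lap
  have s2 : ∀ j : Fin 3, Smooth3 (pd j (pd k Q)) := fun j => (hQ.pd k).pd j
  have hsm : ContDiff ℝ (⊤ : ℕ∞) (stokesTest Q k) := by
    rw [contDiff_euclidean]
    intro j
    exact (s1 j).sub (s2 j)
  have hcs : HasCompactSupport (stokesTest Q k) := by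
    refine HasCompactSupport.intro (K := tsupport Q) hc fun x hx => ?_
    have e1 : lap3 Q x = 0 := by
      refine Finset.sum_eq_zero fun i _ => ?_
      exact image_eq_zero_of_notMem_tsupport fun h => hx (pd_tsupport Q i (pd_tsupport _ i h))
    have e2 : ∀ j, pd j (pd k Q) x = 0 := fun j =>
      image_eq_zero_of_notMem_tsupport fun h => hx (pd_tsupport Q k (pd_tsupport _ j h))
    ext j
    simp [stokesTest, e1, e2]
  have W := hweak.1 _ hsm hcs
  have D := hweak.2 (pd k (lap3 Q)) (hQ.lap.pd k) (hc.lap'.pd' k)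
  have p1 : ∀ i j y, pd i (fun y => stokesTest Q k y j) y =
      (if j = k then 1 else 0) * pd i (lap3 Q) y - pd i (pd j (pd k Q)) y := by
    intro i j y
    rw [hcomp, pd_sub (s1 j) (s2 j), pd_const_mul hQ.lap]
  have p2 : ∀ j y, lap3 (fun y => stokesTest Q k y j) y =
      (if j = k then 1 else 0) * lap3 (lap3 Q) y - pd j (pd k (lap3 Q)) y := by
    intro j y
    have : ∀ i, pd i (fun y => stokesTest Q k y j) =
      fun y => (if j = k then 1 else 0) * pd i (lap3 Q) y - pd i (pd j (pd k Q)) y :=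
      fun i => funext fun y => p1 i j y
    have q : lap3 (pd j (pd k Q)) y = pd j (pd k (lap3 Q)) y := by
      rw [lap_pd (hQ.pd k), lap_pd hQ]
    rw [← q]
    unfold lap3
    simp_rw [this]
    rw [Finset.mul_sum, ← Finset.sum_sub_distrib]
    refine Finset.sum_congr rfl fun i _ => ?_
    have t := hQ.lap.pd i
    have r : pd i (fun y => (if j = k then (1:ℝ) else 0) * pd i (lap3 Q) y - pd i (pd j (pd k Q)) y) y
        = (if j = k then (1:ℝ) else 0) * pd i (pd i (lap3 Q)) y - pd i (pd i (pd j (pd k Q))) y := by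
      rw [pd_sub (contDiff_const.mul t) ((s2 j).pd i), pd_const_mul t]
    exact r
  have p3 : ∀ y, ∑ j : Fin 3, pd j (fun y => stokesTest Q k y j) y = 0 := by
    intro y
    simp_rw [p1]
    have : pd k (lap3 Q) y = ∑ j, pd j (pd j (pd k Q)) y := by
      rw [← lap_pd hQ]; rfl
    rw [Finset.sum_sub_distrib, ← this]
    simp
  simp_rw [p3, p1, p2] at W
  have I1 : Integrable (fun y => u y k * lap3 (lap3 Q) y) :=
    loc_mul_int (loc_ui hu_meas hu_loc k) hQ.lap.lap.continuous hc.lap'.lap'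
  have I2 : Integrable (fun y => ∑ j, u y j * pd j (pd k (lap3 Q)) y) :=
    integrable_finsetSum _ fun j _ => loc_mul_int (loc_ui hu_meas hu_loc j)
      ((hQ.lap.pd k).pd j).continuous ((hc.lap'.pd' k).pd' j)
  have e1 : (∫ x, ∑ j : Fin 3, u x j * ((if j = k then 1 else 0) * lap3 (lap3 Q) x
      - pd j (pd k (lap3 Q)) x)) = ∫ y, u y k * lap3 (lap3 Q) y := by
    have : (fun x => ∑ j : Fin 3, u x j * ((if j = k then 1 else 0) * lap3 (lap3 Q) x
      - pd j (pd k (lap3 Q)) x)) = fun x => u x k * lap3 (lap3 Q) x -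
        ∑ j, u x j * pd j (pd k (lap3 Q)) x := by
      funext x
      simp_rw [mul_sub]
      rw [Finset.sum_sub_distrib]
      simp
    rw [this, integral_sub I1 I2, D, sub_zero]
  rw [e1] at W
  simp only [mul_zero, integral_zero, add_zero] at W
  linarith

def fw (u : E3 → E3) (y : E3) : ℝ≥0∞ := 1 + ENNReal.ofReal (‖u y‖ ^ 2)

def kk (z : E3) : ℝ≥0∞ := ENNReal.ofReal (kr z)

def HH (u : E3 → E3) (a : E3) : ℝ≥0∞ := ∫⁻ y, kk (y - a) * fw u y

def KI (e : ℝ) (z : E3) : ℝ :=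
  if ‖z‖ ^ 2 < 2 then 15 * e ^ 2 * (‖z‖ ^ 2 + e) ^ (-(7 : ℝ) / 2) else 0

lemma enorm_int_le {u : E3 → E3} {F : E3 → ℝ} {C : ℝ} (hC : 0 ≤ C) (a : E3)
    (hF : ∀ y, |F y| ≤ C * (kr (y - a) * (1 + ‖u y‖ ^ 2))) :
    ‖∫ y, F y‖ₑ ≤ ENNReal.ofReal C * HH u a := by
  refine (enorm_integral_le_lintegral_enorm _).trans ?_
  unfold HH
  rw [← lintegral_const_mul' _ _ ENNReal.ofReal_ne_top]
  refine lintegral_mono fun y => ?_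
  rw [Real.enorm_eq_ofReal_abs]
  refine (ENNReal.ofReal_le_ofReal (hF y)).trans (le_of_eq ?_)
  rw [ENNReal.ofReal_mul hC, ENNReal.ofReal_mul (kr_nonneg _),
    ENNReal.ofReal_add zero_le_one (by positivity)]
  simp [fw, kk]

lemma kernel_bound {u : E3 → E3} {P : E3 → ℝ} (hu_meas : Measurable u)
    (hu_loc : LocallyIntegrable (fun x => ‖u x‖ ^ 2) volume)
    (hweak : IsWeakSolutionNS u P) : ∃ C : ℝ, 0 ≤ C ∧ ∀ e, 0 < e → e ≤ 1 → ∀ (a : E3) (k : Fin 3),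
      ‖∫ y, u y k * KI e (y - a)‖ₑ ≤ ENNReal.ofReal C * HH u a := by
  obtain ⟨C, hC0, hC⟩ := third_bound
  refine ⟨C + 9 * (4 * C), by positivity, fun e he he1 a k => ?_⟩
  have hQ := QQ_smooth he a
  have hc := QQ_supp e a
  have W := weak_stokes hu_meas hu_loc hweak hQ hc k
  have I1 : Integrable (fun y => u y k * lap3 (lap3 (QQ e a)) y) :=
    loc_mul_int (loc_ui hu_meas hu_loc k) hQ.lap.lap.continuous hc.lap'.lap'
  have hS : MeasurableSet {y : E3 | 2 ≤ ‖y - a‖ ^ 2} :=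
    measurableSet_le measurable_const (by fun_prop)
  have I2 := I1.indicator hS
  have e1 : (fun y => u y k * KI e (y - a)) = fun y =>
      Set.indicator {y : E3 | 2 ≤ ‖y - a‖ ^ 2} (fun y => u y k * lap3 (lap3 (QQ e a)) y) y -
        u y k * lap3 (lap3 (QQ e a)) y := by
    funext y
    by_cases h : ‖y - a‖ ^ 2 < 2
    · rw [Set.indicator_of_notMem (by simpa using h), lap2_near he h, KI, if_pos h]; ring
    · rw [Set.indicator_of_mem (by simpa using h), KI, if_neg h]; ring
  rw [e1, integral_sub I2 I1, W, sub_neg_eq_add]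
  have hu1 : ∀ y (i : Fin 3), |u y i| ≤ 1 + ‖u y‖ ^ 2 := fun y i => by
    have := abs_coord_le (u y) i
    nlinarith [sq_nonneg (‖u y‖ - 1)]
  have hu2 : ∀ y (i j : Fin 3), |u y i * u y j| ≤ 1 + ‖u y‖ ^ 2 := fun y i j => by
    rw [abs_mul]
    have := mul_le_mul (abs_coord_le (u y) i) (abs_coord_le (u y) j) (abs_nonneg _) (norm_nonneg _)
    nlinarith
  have B1 : ‖∫ y, Set.indicator {y : E3 | 2 ≤ ‖y - a‖ ^ 2}
      (fun y => u y k * lap3 (lap3 (QQ e a)) y) y‖ₑ ≤ ENNReal.ofReal C * HH u a := by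
    refine enorm_int_le hC0 a fun y => ?_
    by_cases h : 2 ≤ ‖y - a‖ ^ 2
    · rw [Set.indicator_of_mem (by simpa using h), abs_mul]
      have := (hC e he he1 a y).2 h
      calc _ ≤ (1 + ‖u y‖ ^ 2) * (C * kr (y - a)) :=
            mul_le_mul (hu1 y k) this (abs_nonneg _) (by positivity)
        _ = _ := by ring
    · rw [Set.indicator_of_notMem (by simpa using h), abs_zero]
      have := kr_nonneg (y - a)
      positivity
  have B2 : ∀ i j : Fin 3, ‖∫ y, u y i * u y j *
      ((if j = k then 1 else 0) * pd i (lap3 (QQ e a)) y - pd i (pd j (pd k (QQ e a))) y)‖ₑ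
        ≤ ENNReal.ofReal (4 * C) * HH u a := by
    intro i j
    refine enorm_int_le (by positivity) a fun y => ?_
    rw [abs_mul]
    have T := (hC e he he1 a y).1
    have t1 : |pd i (lap3 (QQ e a)) y| ≤ 3 * (C * kr (y - a)) := by
      have : pd i (lap3 (QQ e a)) y = ∑ m, pd i (pd m (pd m (QQ e a))) y :=
        pd_sum (fun m => (hQ.pd m).pd m) i y
      rw [this]
      refine (Finset.abs_sum_le_sum_abs _ _).trans ?_
      refine (Finset.sum_le_sum fun m _ => T i m m).trans ?_
      simp
    have t2 : |(if j = k then (1:ℝ) else 0) * pd i (lap3 (QQ e a)) y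
        - pd i (pd j (pd k (QQ e a))) y| ≤ 4 * (C * kr (y - a)) := by
      refine (abs_sub _ _).trans ?_
      have := T i j k
      have t3 : |(if j = k then (1:ℝ) else 0) * pd i (lap3 (QQ e a)) y| ≤ 3 * (C * kr (y - a)) := by
        split_ifs
        · simpa using t1
        · simp; exact mul_nonneg hC0 (kr_nonneg _)
      linarith
    calc _ ≤ (1 + ‖u y‖ ^ 2) * (4 * (C * kr (y - a))) :=
            mul_le_mul (hu2 y i j) t2 (abs_nonneg _) (by positivity)
      _ = _ := by ring
  refine (enorm_add_le _ _).trans ?_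
  rw [ENNReal.ofReal_add hC0 (by positivity), add_mul]
  refine add_le_add B1 ?_
  refine (enorm_sum_le _ _).trans ((Finset.sum_le_sum fun i _ => (enorm_sum_le _ _).trans
    (Finset.sum_le_sum fun j _ => B2 i j)).trans (le_of_eq ?_))
  simp only [Finset.sum_const, Finset.card_univ, Fintype.card_fin, nsmul_eq_mul]
  rw [ENNReal.ofReal_mul (by norm_num : (0:ℝ) ≤ 9)]
  norm_num
  ring


def GG (z : E3) : ℝ := 15 * (1 + ‖z‖ ^ 2) ^ (-(7 : ℝ) / 2)

lemma GG_pos (z : E3) : 0 < GG z := by unfold GG; positivity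

lemma GG_cont : Continuous GG := by
  unfold GG
  refine continuous_const.mul (Continuous.rpow_const (by fun_prop) fun x => Or.inl ?_)
  positivity

lemma GG_int : Integrable GG := by
  have := integrable_rpow_neg_one_add_norm_sq (E := E3) (μ := volume) (r := 7) (by simp; norm_num)
  exact this.const_mul 15

def c0 : ℝ := ∫ z, GG z

lemma c0_pos : 0 < c0 := by
  unfold c0
  rw [integral_pos_iff_support_of_nonneg (fun z => (GG_pos z).le) GG_int]
  have : Function.support GG = Set.univ := by
    ext z; simp [(GG_pos z).ne']
  rw [this]
  simp

lemma KI_scale {s : ℝ} (hs : 0 < s) (z : E3) :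
    KI (s ^ 2)⁻¹ z = if ‖z‖ ^ 2 < 2 then s ^ 3 * GG (s • z) else 0 := by
  unfold KI GG
  split_ifs
  · have h1 : ‖z‖ ^ 2 + (s ^ 2)⁻¹ = (1 + ‖s • z‖ ^ 2) * (s ^ 2)⁻¹ := by
      rw [norm_smul, Real.norm_of_nonneg hs.le]; field_simp; ring
    have h2 : ((s ^ 2)⁻¹) ^ (-(7:ℝ)/2) = s ^ 7 := by
      rw [neg_div, Real.rpow_neg (by positivity), Real.inv_rpow (by positivity), inv_inv,
        ← Real.rpow_natCast s 2, ← Real.rpow_mul hs.le, ← Real.rpow_natCast s 7]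
      norm_num
    rw [h1, Real.mul_rpow (by positivity) (by positivity), h2]
    field_simp
  · rfl

lemma GG_decay : Tendsto (fun x : E3 => ‖x‖ ^ 3 * GG x) (Bornology.cobounded E3) (𝓝 0) := by
  have h : Tendsto (fun t : ℝ => 15 / t) atTop (𝓝 0) := tendsto_const_nhds.div_atTop tendsto_id
  have h2 := h.comp (tendsto_norm_cobounded_atTop (E := E3))
  refine squeeze_zero' (Eventually.of_forall fun x => ?_) ?_ h2
  · have := GG_pos x; positivity
  have h1 := (tendsto_norm_cobounded_atTop (E := E3)).eventually (eventually_ge_atTop 1)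
  filter_upwards [h1] with x hx
  simp only [Function.comp, GG]
  have a1 : (1 + ‖x‖ ^ 2) ^ (-(7:ℝ)/2) ≤ (1 + ‖x‖ ^ 2) ^ (-(2:ℝ)) :=
    Real.rpow_le_rpow_of_exponent_le (by nlinarith) (by norm_num)
  have a2 : (1 + ‖x‖ ^ 2) ^ (-(2:ℝ)) = ((1 + ‖x‖ ^ 2) ^ 2)⁻¹ := by
    rw [Real.rpow_neg (by positivity)]; norm_cast
  rw [a2] at a1
  have hx0 : 0 < ‖x‖ := by linarith
  calc ‖x‖ ^ 3 * (15 * (1 + ‖x‖ ^ 2) ^ (-(7:ℝ)/2)) ≤ ‖x‖ ^ 3 * (15 * ((1 + ‖x‖ ^ 2) ^ 2)⁻¹) := by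
        gcongr
    _ ≤ 15 / ‖x‖ := by
        rw [← div_eq_mul_inv, mul_div_assoc', div_le_div_iff₀ (by positivity) hx0]
        nlinarith [sq_nonneg (‖x‖^2)]

lemma KI_meas (e : ℝ) : Measurable (KI e) := by
  unfold KI
  refine Measurable.ite (measurableSet_lt (by fun_prop) measurable_const) (by fun_prop) measurable_const

lemma KI_nonneg {e : ℝ} (he : 0 < e) (z : E3) : 0 ≤ KI e z := by
  unfold KI; split_ifs <;> positivity

lemma KI_bdd {e : ℝ} (he : 0 < e) (z : E3) : KI e z ≤ 15 * e ^ 2 * e ^ (-(7 : ℝ) / 2) := by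
  unfold KI; split_ifs
  · refine mul_le_mul_of_nonneg_left ?_ (by positivity)
    exact Real.rpow_le_rpow_of_nonpos he (by nlinarith [sq_nonneg ‖z‖]) (by norm_num)
  · positivity

def TT (g : E3 → ℝ) (s : ℝ) (y : E3) : ℝ := ∫ x, g x * KI (s ^ 2)⁻¹ (y - x)

lemma TT_tendsto {g : E3 → ℝ} (hg : Continuous g) (hc : HasCompactSupport g) (y : E3) :
    Tendsto (fun s => TT g s y) atTop (𝓝 (c0 * g y)) := by
  have hS : MeasurableSet {x : E3 | ‖y - x‖ ^ 2 < 2} :=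
    measurableSet_lt (by fun_prop) measurable_const
  have hI : Integrable (Set.indicator {x : E3 | ‖y - x‖ ^ 2 < 2} g) :=
    (hg.integrable_of_hasCompactSupport hc).indicator hS
  have hop : IsOpen {x : E3 | ‖y - x‖ ^ 2 < 2} := isOpen_lt (by fun_prop) continuous_const
  have hyS : y ∈ {x : E3 | ‖y - x‖ ^ 2 < 2} := by simp
  have hC : ContinuousAt (Set.indicator {x : E3 | ‖y - x‖ ^ 2 < 2} g) y := by
    refine hg.continuousAt.congr ?_
    filter_upwards [hop.mem_nhds hyS] with x hx
    simp only [Set.indicator]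
    rw [if_pos]
    exact hx
  have key := tendsto_integral_comp_smul_smul_of_integrable' (μ := (volume : Measure E3))
    (φ := fun z => c0⁻¹ * GG z) (fun x => mul_nonneg (inv_nonneg.2 c0_pos.le) (GG_pos x).le)
    (by rw [integral_const_mul]; exact inv_mul_cancel₀ c0_pos.ne')
    (by
      have := GG_decay.const_mul c0⁻¹
      rw [mul_zero] at this
      refine this.congr fun x => ?_
      simp
      ring) hI hC
  have := key.const_mul c0
  rw [Set.indicator_of_mem hyS] at this
  refine this.congr' ?_
  filter_upwards [eventually_gt_atTop 0] with s hs
  rw [← integral_const_mul, TT]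
  refine integral_congr_ae (Eventually.of_forall fun x => ?_)
  simp only [KI_scale hs, smul_eq_mul, Set.indicator, Set.mem_ofPred_eq]
  split_ifs
  · have := c0_pos.ne'
    simp
    field_simp
  · simp

lemma TT_bdd {g : E3 → ℝ} {M : ℝ} (hM : ∀ x, |g x| ≤ M) {s : ℝ} (hs : 0 < s) (y : E3) :
    |TT g s y| ≤ M * c0 := by
  have hM0 : 0 ≤ M := (abs_nonneg _).trans (hM 0)
  have i1 : Integrable (fun z => s ^ 3 * GG (s • z)) :=
    (GG_int.comp_smul hs.ne').const_mul _
  have i2 : Integrable (fun x => M * (s ^ 3 * GG (s • (y - x)))) :=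
    (i1.comp_sub_left y).const_mul M
  have e : ∫ x, M * (s ^ 3 * GG (s • (y - x))) = M * c0 := by
    rw [integral_const_mul, integral_sub_left_eq_self (fun z => s ^ 3 * GG (s • z)) volume y,
      integral_const_mul, Measure.integral_comp_smul]
    have : Module.finrank ℝ E3 = 3 := by simp
    rw [this, abs_of_pos (by positivity)]
    simp only [smul_eq_mul, c0]
    field_simp
  rw [← e, ← Real.norm_eq_abs]
  refine norm_integral_le_of_norm_le i2 (Eventually.of_forall fun x => ?_)
  rw [norm_mul]
  refine mul_le_mul (hM x) ?_ (norm_nonneg _) hM0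
  rw [Real.norm_of_nonneg (KI_nonneg (by positivity) _), KI_scale hs]
  have := (GG_pos (s • (y - x))).le
  split_ifs
  · exact le_rfl
  · positivity

lemma pt1 {u : E3 → E3} {C : ℝ} (hu_meas : Measurable u)
    (hu_loc : LocallyIntegrable (fun x => ‖u x‖ ^ 2) volume) (k : Fin 3)
    (hC : ∀ e, 0 < e → e ≤ 1 → ∀ (a : E3) (k : Fin 3),
      ‖∫ y, u y k * KI e (y - a)‖ₑ ≤ ENNReal.ofReal C * HH u a)
    {g : E3 → ℝ} (hg : Continuous g) (hc : HasCompactSupport g) (hg0 : ∀ x, 0 ≤ g x) :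
    ‖∫ y, u y k * (c0 * g y)‖ₑ ≤ ENNReal.ofReal C * ∫⁻ x, ENNReal.ofReal (g x) * HH u x := by
  obtain ⟨R, hR⟩ := hc.isBounded.subset_closedBall (0 : E3)
  obtain ⟨M, hM⟩ := hg.bounded_above_of_compact_support hc
  have gz : ∀ x, R < ‖x‖ → g x = 0 := fun x hx => by
    by_contra h
    have := hR (subset_closure h)
    simp at this
    linarith
  have uk := loc_ui hu_meas hu_loc k
  set B : Set E3 := closedBall 0 (R + 2) with hB
  have hBm : MeasurableSet B := measurableSet_closedBall
  have uB : Integrable (B.indicator fun y => u y k) :=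
    (integrable_indicator_iff hBm).2 (uk.integrableOn_isCompact (isCompact_closedBall _ _))
  have kz : ∀ e x y, y ∉ B → g x * KI e (y - x) = 0 := by
    intro e x y hy
    by_cases hx : R < ‖x‖
    · rw [gz x hx, zero_mul]
    · have h1 : R + 2 < ‖y‖ := by simpa [hB] using hy
      have h2 : 2 ≤ ‖y - x‖ := by
        have := norm_sub_norm_le y x
        push Not at hx
        linarith
      rw [KI, if_neg (by nlinarith), mul_zero]
  have Tz : ∀ s y, y ∉ B → TT g s y = 0 := by
    intro s y hy
    unfold TT
    simp_rw [kz _ _ y hy]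
    simp
  have swap : ∀ s, 0 < s → ∫ y, u y k * TT g s y = ∫ x, g x * ∫ y, u y k * KI (s ^ 2)⁻¹ (y - x) := by
    intro s hs
    have hs2 : 0 < (s ^ 2)⁻¹ := by positivity
    have I : Integrable (Function.uncurry fun (y x : E3) =>
        KI (s ^ 2)⁻¹ (y - x) * (B.indicator (fun y => u y k) y * g x)) (volume.prod volume) := by
      refine (uB.mul_prod (hg.integrable_of_hasCompactSupport hc)).bdd_mul (c := 15 * (s^2)⁻¹ ^ 2 * (s^2)⁻¹ ^ (-(7 : ℝ) / 2)) ?_ ?_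
      · exact ((KI_meas _).comp (measurable_fst.sub measurable_snd)).aestronglyMeasurable
      · refine Eventually.of_forall fun z => ?_
        rw [Real.norm_of_nonneg (KI_nonneg hs2 _)]
        exact KI_bdd hs2 _
    have := integral_integral_swap I
    calc _ = ∫ y, ∫ x, KI (s ^ 2)⁻¹ (y - x) * (B.indicator (fun y => u y k) y * g x) := by
          refine integral_congr_ae (Eventually.of_forall fun y => ?_)
          simp only [TT]
          rw [← integral_const_mul]
          refine integral_congr_ae (Eventually.of_forall fun x => ?_)
          simp only
          by_cases hy : y ∈ B
          · rw [Set.indicator_of_mem hy]; ring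
          · rw [kz _ x y hy, Set.indicator_of_notMem hy]; ring
      _ = _ := this
      _ = _ := by
          refine integral_congr_ae (Eventually.of_forall fun x => ?_)
          simp only
          rw [← integral_const_mul]
          refine integral_congr_ae (Eventually.of_forall fun y => ?_)
          simp only
          by_cases hy : y ∈ B
          · rw [Set.indicator_of_mem hy]; ring
          · have := kz (s^2)⁻¹ x y hy
            rw [Set.indicator_of_notMem hy]
            linear_combination (-u y k) * this
  have bd : ∀ᶠ s in atTop, ‖∫ y, u y k * TT g s y‖ₑ ≤
      ENNReal.ofReal C * ∫⁻ x, ENNReal.ofReal (g x) * HH u x := by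
    filter_upwards [eventually_ge_atTop 1] with s hs
    rw [swap s (by linarith), ← lintegral_const_mul' _ _ ENNReal.ofReal_ne_top]
    refine (enorm_integral_le_lintegral_enorm _).trans (lintegral_mono fun x => ?_)
    have := hC (s^2)⁻¹ (by positivity) (inv_le_one_of_one_le₀ (by nlinarith)) x k
    rw [enorm_mul, Real.enorm_eq_ofReal (hg0 x)]
    calc _ ≤ ENNReal.ofReal (g x) * (ENNReal.ofReal C * HH u x) := by gcongr
      _ = _ := by ring
  have lim : Tendsto (fun s => ∫ y, u y k * TT g s y) atTop (𝓝 (∫ y, u y k * (c0 * g y))) := by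
    refine tendsto_integral_filter_of_dominated_convergence
      (fun y => ‖B.indicator (fun y => u y k) y‖ * (M * c0)) ?_ ?_ ?_ ?_
    · refine Eventually.of_forall fun s => ?_
      refine uk.aestronglyMeasurable.mul ?_
      have : StronglyMeasurable (Function.uncurry fun (y x : E3) => g x * KI (s ^ 2)⁻¹ (y - x)) :=
        ((hg.measurable.comp measurable_snd).mul
          ((KI_meas _).comp (measurable_fst.sub measurable_snd))).stronglyMeasurable
      exact this.integral_prod_right.aestronglyMeasurable
    · filter_upwards [eventually_gt_atTop 0] with s hs
      refine Eventually.of_forall fun y => ?_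
      by_cases hy : y ∈ B
      · rw [Set.indicator_of_mem hy, norm_mul]
        exact mul_le_mul_of_nonneg_left (TT_bdd hM hs y) (norm_nonneg _)
      · rw [Tz s y hy, Set.indicator_of_notMem hy]; simp
    · exact uB.norm.mul_const _
    · exact Eventually.of_forall fun y => (TT_tendsto hg hc y).const_mul _
  exact le_of_tendsto (continuous_enorm.continuousAt.tendsto.comp lim) bd

lemma kk_meas : Measurable kk := by
  unfold kk kr
  refine Measurable.ennreal_ofReal (Measurable.ite (measurableSet_lt (by fun_prop) measurable_const)
    (by fun_prop) measurable_const)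

lemma fw_meas {u : E3 → E3} (hu : Measurable u) : Measurable (fw u) := by
  unfold fw
  fun_prop

lemma kk_far {z : E3} (hz : 2 ≤ ‖z‖) : kk z = 0 := by
  unfold kk kr
  rw [if_neg (by linarith)]; simp

lemma kk_neg (z : E3) : kk (-z) = kk z := by simp [kk, kr]

lemma kk_pow_int {s : ℝ} (hs0 : 0 < s) (hs : s < 3 / 2) : ∫⁻ z, kk z ^ s < ∞ := by
  have h1 : IntegrableOn (fun z : E3 => (fun t : ℝ => ((t ^ 2)⁻¹) ^ s) ‖z‖) (ball 0 2) volume := by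
    refine (integrableOn_fun_norm_addHaar (volume : Measure E3) (f := fun t : ℝ => ((t ^ 2)⁻¹) ^ s)).2 ?_
    have h2 : IntegrableOn (fun y : ℝ => y ^ (2 - 2 * s)) (Set.Ioo 0 2) :=
      (intervalIntegral.integrableOn_Ioo_rpow_iff (by norm_num)).2 (by linarith)
    refine h2.congr_fun (fun y hy => ?_) measurableSet_Ioo
    have hy0 : 0 < y := hy.1
    have : Module.finrank ℝ E3 - 1 = 2 := by simp
    simp only [this, smul_eq_mul]
    rw [Real.inv_rpow (by positivity), ← Real.rpow_natCast y 2, ← Real.rpow_mul hy0.le,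
      ← Real.rpow_neg hy0.le, ← Real.rpow_add hy0]
    norm_num
    ring_nf
  have h3 : ∫⁻ z in ball (0 : E3) 2, ENNReal.ofReal (((‖z‖ ^ 2)⁻¹) ^ s) < ∞ := by
    have := h1.2
    rw [hasFiniteIntegral_iff_norm] at this
    refine lt_of_le_of_lt (lintegral_mono fun z => ?_) this
    exact ENNReal.ofReal_le_ofReal (le_abs_self _)
  rw [← lintegral_indicator measurableSet_ball] at h3
  refine lt_of_le_of_lt (lintegral_mono fun z => ?_) h3
  by_cases hz : ‖z‖ < 2
  · rw [Set.indicator_of_mem (by simpa using hz), kk, kr, if_pos hz,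
      ENNReal.ofReal_rpow_of_nonneg (by positivity) hs0.le]
  · rw [kk_far (by linarith), ENNReal.zero_rpow_of_pos hs0]
    exact zero_le

lemma kk_int : ∫⁻ z, kk z < ∞ := by
  have := kk_pow_int (s := 1) (by norm_num) (by norm_num)
  simpa using this

lemma kk_pos : 0 < ∫⁻ z, kk z := by
  rw [lintegral_pos_iff_support kk_meas]
  have : ball (0:E3) 2 \ {0} ⊆ Function.support kk := by
    intro z hz
    have h1 : ‖z‖ < 2 := by simpa using hz.1
    have h2 : z ≠ 0 := by simpa using hz.2
    have h3 : 0 < ‖z‖ := norm_pos_iff.2 h2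
    simp only [Function.mem_support, kk, kr, if_pos h1, ne_eq, ENNReal.ofReal_eq_zero, not_le]
    positivity
  refine lt_of_lt_of_le ?_ (measure_mono this)
  rw [measure_sdiff_null (by simp)]
  exact measure_ball_pos _ _ (by norm_num)

lemma HH_meas {u : E3 → E3} (hu : Measurable u) : Measurable (HH u) := by
  unfold HH
  have : Measurable (Function.uncurry fun (x y : E3) => kk (y - x) * fw u y) :=
    (kk_meas.comp (measurable_snd.sub measurable_fst)).mul ((fw_meas hu).comp measurable_snd)
  exact this.lintegral_prod_right

lemma HH_lower {u : E3 → E3} (a : E3) : ∫⁻ z, kk z ≤ HH u a := by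
  unfold HH
  rw [← lintegral_sub_right_eq_self kk a]
  refine lintegral_mono fun y => ?_
  calc kk (y - a) = kk (y - a) * 1 := (mul_one _).symm
    _ ≤ _ := by
      gcongr
      unfold fw
      exact le_self_add

lemma fw_loc {u : E3 → E3} 
    (hu_loc : LocallyIntegrable (fun x => ‖u x‖ ^ 2) volume) (R : ℝ) :
    ∫⁻ x in ball (0:E3) R, fw u x < ∞ := by
  have h1 : IntegrableOn (fun x => ‖u x‖ ^ 2) (ball (0:E3) R) :=
    (hu_loc.integrableOn_isCompact (isCompact_closedBall 0 R)).mono_set ball_subset_closedBall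
  unfold fw
  rw [lintegral_add_left measurable_const]
  refine ENNReal.add_lt_top.2 ⟨?_, ?_⟩
  · rw [setLIntegral_const, one_mul]
    exact measure_ball_lt_top
  · have := h1.2
    rw [hasFiniteIntegral_iff_norm] at this
    refine lt_of_le_of_lt (lintegral_mono fun z => ?_) this
    exact ENNReal.ofReal_le_ofReal (le_abs_self _)

lemma HH_loc {u : E3 → E3} (hu : Measurable u)
    (hu_loc : LocallyIntegrable (fun x => ‖u x‖ ^ 2) volume) (R : ℝ) :
    ∫⁻ x in ball (0:E3) R, HH u x < ∞ := by
  unfold HH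
  rw [lintegral_lintegral_swap]
  swap
  · exact ((kk_meas.comp (measurable_snd.sub measurable_fst)).mul ((fw_meas hu).comp measurable_snd)).aemeasurable
  have h1 : ∫⁻ y, (ball (0:E3) (R + 2)).indicator (fun y => fw u y * ∫⁻ z, kk z) y < ∞ := by
    rw [lintegral_indicator measurableSet_ball, lintegral_mul_const _ (fw_meas hu)]
    exact ENNReal.mul_lt_top (fw_loc hu_loc _) kk_int
  refine lt_of_le_of_lt (lintegral_mono fun y => ?_) h1
  by_cases hy : y ∈ ball (0:E3) (R + 2)
  · rw [Set.indicator_of_mem hy]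
    rw [lintegral_mul_const _ (show Measurable fun x => kk (y - x) from kk_meas.comp (measurable_const.sub measurable_id)), mul_comm]
    refine mul_le_mul_right ?_ _
    rw [← lintegral_sub_left_eq_self kk y]
    exact setLIntegral_le_lintegral _ _
  · rw [Set.indicator_of_notMem hy]
    refine le_of_eq (setLIntegral_eq_zero measurableSet_ball fun x hx => ?_)
    have h1 : R + 2 ≤ ‖y‖ := by simpa using hy
    have h2 : ‖x‖ < R := by simpa using hx
    have := norm_sub_norm_le y x
    simp only [Pi.zero_apply]
    rw [kk_far (by linarith), zero_mul]

def bmp (n : ℕ) : ContDiffBump (0 : E3) where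
  rIn := 1 / (2 * ((n : ℝ) + 1))
  rOut := 1 / ((n : ℝ) + 1)
  rIn_pos := by positivity
  rIn_lt_rOut := by
    have : (0:ℝ) ≤ n := by positivity
    exact one_div_lt_one_div_of_lt (by positivity) (by linarith)

def eta (n : ℕ) : E3 → ℝ := (bmp n).normed volume

lemma eta_smooth (n : ℕ) : Smooth3 (eta n) := (bmp n).contDiff_normed
lemma eta_nonneg (n : ℕ) (z : E3) : 0 ≤ eta n z := (bmp n).nonneg_normed z
lemma eta_one (n : ℕ) : ∫ z, eta n z = 1 := (bmp n).integral_normed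
lemma eta_cs (n : ℕ) : HasCompactSupport (eta n) := (bmp n).hasCompactSupport_normed
lemma eta_far (n : ℕ) {z : E3} (hz : 1 / ((n : ℝ) + 1) ≤ ‖z‖) : eta n z = 0 := by
  by_contra h
  have : z ∈ Function.support ((bmp n).normed volume) := h
  rw [ContDiffBump.support_normed_eq] at this
  have h2 : ‖z‖ < (bmp n).rOut := by simpa using this
  have h3 : (bmp n).rOut = 1 / ((n : ℝ) + 1) := rfl
  linarith

def mol (n : ℕ) (f : E3 → ℝ) (x : E3) : ℝ := ∫ y, eta n (x - y) * f y

lemma mol_ae {f : E3 → ℝ} (hf : LocallyIntegrable f volume) :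
    ∀ᵐ x, Tendsto (fun n => mol n f x) atTop (𝓝 (f x)) := by
  have h1 : Tendsto (fun n => (bmp n).rOut) atTop (𝓝 0) := tendsto_one_div_add_atTop_nhds_zero_nat
  have h2 : ∀ᶠ n in atTop, (bmp n).rOut ≤ 2 * (bmp n).rIn := by
    refine Eventually.of_forall fun n => le_of_eq ?_
    show 1 / ((n : ℝ) + 1) = 2 * (1 / (2 * ((n : ℝ) + 1)))
    field_simp
  filter_upwards [ContDiffBump.ae_convolution_tendsto_right_of_locallyIntegrable h1 h2 hf] with x hx
  refine hx.congr fun n => ?_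
  rw [convolution_eq_swap]
  rfl

lemma eta_shift_cont (n : ℕ) (x : E3) : Continuous (fun y => eta n (x - y)) :=
  (eta_smooth n).continuous.comp (continuous_const.sub continuous_id)

lemma eta_shift_cs (n : ℕ) (x : E3) : HasCompactSupport (fun y => eta n (x - y)) :=
  (eta_cs n).comp_homeomorph (Homeomorph.subLeft x)

lemma mol_int {f : E3 → ℝ} (hf : LocallyIntegrable f volume) (n : ℕ) (x : E3) :
    Integrable (fun y => eta n (x - y) * f y) := by
  have := loc_mul_int hf (eta_shift_cont n x) (eta_shift_cs n x)
  simpa [mul_comm] using this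

lemma HH_fin {u : E3 → E3} (hu : Measurable u)
    (hu_loc : LocallyIntegrable (fun x => ‖u x‖ ^ 2) volume) : ∀ᵐ x, HH u x < ∞ := by
  have : ∀ n : ℕ, ∀ᵐ x, x ∈ ball (0:E3) n → HH u x < ∞ := fun n =>
    ae_imp_of_ae_restrict (ae_lt_top (HH_meas hu) (HH_loc hu hu_loc n).ne)
  rw [← ae_all_iff] at this
  filter_upwards [this] with x hx
  obtain ⟨n, hn⟩ := exists_nat_gt ‖x‖
  exact hx n (by simpa using hn)

lemma HHr_loc {u : E3 → E3} (hu : Measurable u)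
    (hu_loc : LocallyIntegrable (fun x => ‖u x‖ ^ 2) volume) :
    LocallyIntegrable (fun x => (HH u x).toReal) volume := by
  rw [locallyIntegrable_iff]
  intro K hK
  obtain ⟨R, hR⟩ := hK.isBounded.subset_ball (0:E3)
  refine IntegrableOn.mono_set ?_ hR
  exact integrable_toReal_of_lintegral_ne_top (HH_meas hu).aemeasurable (HH_loc hu hu_loc R).ne

lemma pt2 {u : E3 → E3} {P : E3 → ℝ} (hu_meas : Measurable u)
    (hu_loc : LocallyIntegrable (fun x => ‖u x‖ ^ 2) volume)
    (hweak : IsWeakSolutionNS u P) : ∃ C : ℝ, 0 ≤ C ∧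
      ∀ᵐ x, ENNReal.ofReal ‖u x‖ ≤ ENNReal.ofReal C * HH u x := by
  obtain ⟨C, hC0, hC⟩ := kernel_bound hu_meas hu_loc hweak
  have hH := HHr_loc hu_meas hu_loc
  have hfin := HH_fin hu_meas hu_loc
  have key : ∀ k : Fin 3, ∀ᵐ x, c0 * |u x k| ≤ C * (HH u x).toReal := by
    intro k
    filter_upwards [mol_ae (loc_ui hu_meas hu_loc k), mol_ae hH] with x h1 h2
    refine le_of_tendsto_of_tendsto' (h1.abs.const_mul c0) (h2.const_mul C) fun n => ?_
    have := pt1 hu_meas hu_loc k hC (eta_shift_cont n x) (eta_shift_cs n x) (fun y => eta_nonneg n _)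
    have e1 : ∫⁻ y, ENNReal.ofReal (eta n (x - y)) * HH u y =
        ENNReal.ofReal (mol n (fun x => (HH u x).toReal) x) := by
      unfold mol
      rw [ofReal_integral_eq_lintegral_ofReal (mol_int hH n x)
        (Eventually.of_forall fun y => mul_nonneg (eta_nonneg _ _) ENNReal.toReal_nonneg)]
      refine lintegral_congr_ae ?_
      filter_upwards [hfin] with y hy
      rw [ENNReal.ofReal_mul (eta_nonneg _ _), ENNReal.ofReal_toReal hy.ne]
    have e2 : ∫ y, u y k * (c0 * eta n (x - y)) = c0 * mol n (fun x => u x k) x := by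
      unfold mol
      rw [← integral_const_mul]
      refine integral_congr_ae (Eventually.of_forall fun y => ?_)
      simp only
      ring
    have hm : 0 ≤ mol n (fun x => (HH u x).toReal) x :=
      integral_nonneg fun y => mul_nonneg (eta_nonneg _ _) ENNReal.toReal_nonneg
    rw [e1, e2, Real.enorm_eq_ofReal_abs, ← ENNReal.ofReal_mul hC0,
      ENNReal.ofReal_le_ofReal_iff (by positivity), abs_mul, abs_of_pos c0_pos] at this
    exact this
  have hc := c0_pos
  refine ⟨3 * (C / c0), by positivity, ?_⟩
  filter_upwards [ae_all_iff.2 key, hfin] with x hx hf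
  rw [← ENNReal.ofReal_toReal hf.ne, ← ENNReal.ofReal_mul (by positivity)]
  apply ENNReal.ofReal_le_ofReal
  have hn : ‖u x‖ ≤ ∑ k, |u x k| := by
    rw [EuclideanSpace.norm_eq]
    apply Real.sqrt_le_iff.2
    refine ⟨Finset.sum_nonneg fun _ _ => abs_nonneg _, ?_⟩
    simp only [Real.norm_eq_abs, Fin.sum_univ_three]
    nlinarith [abs_nonneg (u x 0), abs_nonneg (u x 1), abs_nonneg (u x 2),
      mul_nonneg (abs_nonneg (u x 0)) (abs_nonneg (u x 1)),
      mul_nonneg (abs_nonneg (u x 0)) (abs_nonneg (u x 2)),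
      mul_nonneg (abs_nonneg (u x 1)) (abs_nonneg (u x 2))]
  have hk : ∀ k, |u x k| ≤ C / c0 * (HH u x).toReal := fun k => by
    rw [div_mul_eq_mul_div, le_div_iff₀ hc, mul_comm]
    exact hx k
  rw [Fin.sum_univ_three] at hn
  linarith [hk 0, hk 1, hk 2]


lemma fw_le {u : E3 → E3} {C : ℝ} (hC : 0 ≤ C)
    (h : ∀ᵐ x, ENNReal.ofReal ‖u x‖ ≤ ENNReal.ofReal C * HH u x) :
    ∃ K : ℝ≥0∞, K ≠ ∞ ∧ ∀ᵐ x, fw u x ≤ K * HH u x ^ 2 := by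
  set k0 := ∫⁻ z, kk z with hk0
  have h0 : k0 ≠ 0 := kk_pos.ne'
  have ht : k0 ≠ ∞ := kk_int.ne
  refine ⟨(k0⁻¹) ^ 2 + ENNReal.ofReal C ^ 2, ?_, ?_⟩
  · refine ENNReal.add_ne_top.2 ⟨ENNReal.pow_ne_top (ENNReal.inv_ne_top.2 h0),
      ENNReal.pow_ne_top ENNReal.ofReal_ne_top⟩
  filter_upwards [h] with x hx
  unfold fw
  rw [add_mul, ENNReal.ofReal_pow (norm_nonneg _), ← mul_pow, ← mul_pow]
  gcongr
  refine one_le_pow_of_one_le' ?_ 2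
  calc (1:ℝ≥0∞) = k0⁻¹ * k0 := (ENNReal.inv_mul_cancel h0 ht).symm
    _ ≤ _ := by gcongr; exact HH_lower x

def AA (u : E3 → E3) (m : ℝ) : Prop := ∀ R : ℝ, ∫⁻ x in ball (0:E3) R, fw u x ^ m < ∞

lemma one_le_fw (u : E3 → E3) (x : E3) : 1 ≤ fw u x := le_self_add

lemma AA.mono {u : E3 → E3} {m m' : ℝ} (h : AA u m) (hm : m' ≤ m) : AA u m' := fun R =>
  lt_of_le_of_lt (lintegral_mono fun x => ENNReal.rpow_le_rpow_of_exponent_le (one_le_fw u x) hm) (h R)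

lemma HH_cut {u : E3 → E3} {R : ℝ} {x : E3} (hx : x ∈ ball (0:E3) R) :
    HH u x = ∫⁻ y, kk (y - x) * (ball (0:E3) (R+2)).indicator (fw u) y := by
  unfold HH
  refine lintegral_congr fun y => ?_
  by_cases hy : y ∈ ball (0:E3) (R + 2)
  · rw [Set.indicator_of_mem hy]
  · have h1 : R + 2 ≤ ‖y‖ := by simpa using hy
    have h2 : ‖x‖ < R := by simpa using hx
    have := norm_sub_norm_le y x
    rw [kk_far (by linarith), zero_mul, zero_mul]

lemma cut_pow {u : E3 → E3} (hu : Measurable u) {m : ℝ} (hm : 0 < m) (R : ℝ) :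
    ∫⁻ y, (ball (0:E3) R).indicator (fw u) y ^ m = ∫⁻ x in ball (0:E3) R, fw u x ^ m := by
  rw [← lintegral_indicator measurableSet_ball]
  refine lintegral_congr fun y => ?_
  by_cases hy : y ∈ ball (0:E3) R
  · rw [Set.indicator_of_mem hy, Set.indicator_of_mem hy]
  · rw [Set.indicator_of_notMem hy, Set.indicator_of_notMem hy, ENNReal.zero_rpow_of_pos hm]

lemma young_step {u : E3 → E3} (hu : Measurable u) {m s q : ℝ} (hm : 1 ≤ m) (hs1 : 1 ≤ s)
    (hs : s < 3 / 2) (hq : 0 < q) (he : 1 / q = 1 / s + 1 / m - 1) (hA : AA u m) (R : ℝ) :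
    ∫⁻ x in ball (0:E3) R, HH u x ^ q < ∞ := by
  have hm0 : 0 < m := by linarith
  have hs0 : 0 < s := by linarith
  set f : E3 → ℝ≥0∞ := (ball (0:E3) (R+2)).indicator (fw u) with hf
  have fm : Measurable f := (fw_meas hu).indicator measurableSet_ball
  have kkm : ∀ x : E3, Measurable fun y => kk (y - x) := fun x =>
    kk_meas.comp (measurable_id.sub measurable_const)
  set N1 := ∫⁻ z, kk z ^ s with hN1
  set N2 := ∫⁻ z, f z ^ m with hN2
  have hN1t : N1 < ∞ := kk_pow_int hs0 hs
  have hN2t : N2 < ∞ := by rw [hN2, hf, cut_pow hu hm0]; exact hA _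
  have i1 : 1 / m ≤ 1 := by rw [div_le_one hm0]; exact hm
  have i2 : 1 / s ≤ 1 := by rw [div_le_one hs0]; exact hs1
  have w1 : 0 ≤ 1 / s - 1 / q := by rw [he]; linarith
  have w2 : 0 ≤ 1 / m - 1 / q := by rw [he]; linarith
  have w0 : 0 < 1 / q := by positivity
  have pt : ∀ x ∈ ball (0:E3) R, HH u x ^ q ≤
      (∫⁻ y, kk (y - x) ^ s * f y ^ m) * (N1 ^ (1 / s - 1 / q) * N2 ^ (1 / m - 1 / q)) ^ q := by
    intro x hx
    rw [HH_cut hx]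
    set F : Fin 3 → E3 → ℝ≥0∞ := ![fun y => kk (y - x) ^ s * f y ^ m, fun y => kk (y - x) ^ s,
      fun y => f y ^ m] with hF
    set w : Fin 3 → ℝ := ![1 / q, 1 / s - 1 / q, 1 / m - 1 / q] with hw
    have H := ENNReal.lintegral_prod_norm_pow_le (μ := (volume : Measure E3)) Finset.univ (f := F)
      (p := w)
      (by
        intro i _
        fin_cases i
        · exact (((kkm x).pow_const s).mul (fm.pow_const m)).aemeasurable
        · exact ((kkm x).pow_const s).aemeasurable
        · exact (fm.pow_const m).aemeasurable)
      (by simp [hw, Fin.sum_univ_three]; simp at he; linarith)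
      (by
        intro i _
        fin_cases i
        · exact w0.le
        · exact w1
        · exact w2)
    simp only [Fin.prod_univ_three, hF, hw, Matrix.cons_val_zero, Matrix.cons_val_one,
      Matrix.cons_val] at H
    have e1 : ∀ y, kk (y - x) * f y = (kk (y - x) ^ s * f y ^ m) ^ (1 / q) *
        (kk (y - x) ^ s) ^ (1 / s - 1 / q) * (f y ^ m) ^ (1 / m - 1 / q) := by
      intro y
      rw [ENNReal.mul_rpow_of_nonneg _ _ w0.le, ← ENNReal.rpow_mul, ← ENNReal.rpow_mul,
        ← ENNReal.rpow_mul, ← ENNReal.rpow_mul]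
      have a1 : kk (y - x) ^ (s * (1/q)) * kk (y - x) ^ (s * (1/s - 1/q)) = kk (y - x) := by
        rw [← ENNReal.rpow_add_of_nonneg _ _ (by positivity) (by positivity)]
        have : s * (1/q) + s * (1/s - 1/q) = 1 := by field_simp; ring
        rw [this, ENNReal.rpow_one]
      have a2 : f y ^ (m * (1/q)) * f y ^ (m * (1/m - 1/q)) = f y := by
        rw [← ENNReal.rpow_add_of_nonneg _ _ (by positivity) (by positivity)]
        have : m * (1/q) + m * (1/m - 1/q) = 1 := by field_simp; ring
        rw [this, ENNReal.rpow_one]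
      calc kk (y - x) * f y = (kk (y - x) ^ (s * (1/q)) * kk (y - x) ^ (s * (1/s - 1/q))) *
            (f y ^ (m * (1/q)) * f y ^ (m * (1/m - 1/q))) := by rw [a1, a2]
        _ = _ := by ring
    have e2 : ∫⁻ y, kk (y - x) ^ s = N1 := lintegral_sub_right_eq_self (fun z => kk z ^ s) x
    simp_rw [← e1] at H
    rw [e2, ← hN2] at H
    calc _ ≤ ((∫⁻ y, kk (y - x) ^ s * f y ^ m) ^ (1 / q) * N1 ^ (1 / s - 1 / q) * N2 ^ (1 / m - 1 / q)) ^ q :=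
          ENNReal.rpow_le_rpow H hq.le
      _ = _ := by
          rw [mul_assoc, ENNReal.mul_rpow_of_nonneg _ _ hq.le, ← ENNReal.rpow_mul,
            one_div_mul_cancel hq.ne', ENNReal.rpow_one]
  have mJ : Measurable (Function.uncurry fun (x y : E3) => kk (y - x) ^ s * f y ^ m) :=
    ((kk_meas.comp (measurable_snd.sub measurable_fst)).pow_const s).mul
      ((fm.comp measurable_snd).pow_const m)
  refine lt_of_le_of_lt (setLIntegral_mono' measurableSet_ball pt) ?_
  rw [lintegral_mul_const _ mJ.lintegral_prod_right]
  refine ENNReal.mul_lt_top ?_ ?_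
  · refine lt_of_le_of_lt (setLIntegral_le_lintegral _ _) ?_
    rw [lintegral_lintegral_swap mJ.aemeasurable]
    have : ∀ y, ∫⁻ x, kk (y - x) ^ s * f y ^ m = N1 * f y ^ m := by
      intro y
      rw [lintegral_mul_const _ (show Measurable fun x => kk (y - x) ^ s from
        (kk_meas.comp (measurable_const.sub measurable_id)).pow_const s),
        lintegral_sub_left_eq_self (fun z => kk z ^ s) y]
    simp_rw [this]
    rw [lintegral_const_mul _ (fm.pow_const m)]
    exact ENNReal.mul_lt_top hN1t hN2t
  · refine ENNReal.rpow_lt_top_of_nonneg hq.le (ENNReal.mul_ne_top ?_ ?_)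
    · exact (ENNReal.rpow_lt_top_of_nonneg w1 hN1t.ne).ne
    · exact (ENNReal.rpow_lt_top_of_nonneg w2 hN2t.ne).ne

lemma boot_step {u : E3 → E3} (hu : Measurable u) {K : ℝ≥0∞} (hK : K ≠ ∞)
    (h : ∀ᵐ x, fw u x ≤ K * HH u x ^ 2) {D : ℝ} (hD : 0 < D) (hD2 : D ≤ 1 / 3)
    (hA : AA u (1 / (2 / 3 - D))) : AA u (1 / (2 / 3 - 3 / 2 * D)) := by
  intro R
  have a1 : 0 < 2 / 3 - D := by linarith
  have a2 : 0 < 2 / 3 - 3 / 2 * D := by linarith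
  have a3 : 0 < 2 / 3 + D / 4 := by linarith
  set q : ℝ := 2 * (1 / (2 / 3 - 3 / 2 * D)) with hq
  have hq0 : 0 < q := by positivity
  have Y := young_step hu (m := 1 / (2 / 3 - D)) (s := 1 / (2 / 3 + D / 4)) (q := q)
    (by rw [le_div_iff₀ a1]; linarith) (by rw [le_div_iff₀ a3]; linarith)
    (by rw [div_lt_iff₀ a3]; linarith) hq0
    (by rw [hq, one_div_one_div, one_div_one_div]; field_simp; ring) hA R
  have e : 1 / (2 / 3 - 3 / 2 * D) = q / 2 := by rw [hq]; ring
  rw [e]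
  have : ∫⁻ x in ball (0:E3) R, fw u x ^ (q / 2) ≤ ∫⁻ x in ball (0:E3) R, K ^ (q/2) * HH u x ^ q := by
    refine lintegral_mono_ae (ae_restrict_of_ae ?_)
    filter_upwards [h] with x hx
    calc fw u x ^ (q/2) ≤ (K * HH u x ^ 2) ^ (q/2) := ENNReal.rpow_le_rpow hx (by positivity)
      _ = _ := by
        rw [ENNReal.mul_rpow_of_nonneg _ _ (by positivity), ← ENNReal.rpow_natCast, ← ENNReal.rpow_mul]
        congr 2
        push_cast; ring
  refine lt_of_le_of_lt this ?_
  rw [lintegral_const_mul' _ _ (ENNReal.rpow_lt_top_of_nonneg (by positivity) hK).ne]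
  exact ENNReal.mul_lt_top (ENNReal.rpow_lt_top_of_nonneg (by positivity) hK) Y

lemma boot {u : E3 → E3} (hu : Measurable u) {K : ℝ≥0∞} (hK : K ≠ ∞)
    (h : ∀ᵐ x, fw u x ≤ K * HH u x ^ 2) {m : ℝ} (hm : 3 / 2 < m) (hA : AA u m) : AA u 6 := by
  have mono : ∀ {D D' : ℝ}, D ≤ D' → D' < 2 / 3 → AA u (1 / (2/3 - D')) → AA u (1 / (2/3 - D)) := by
    intro D D' h1 h2 hA
    exact hA.mono (one_div_le_one_div_of_le (by linarith) (by linarith))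
  set D0 : ℝ := 2 / 3 - 1 / m with hD0
  have hm0 : 0 < m := by linarith
  have D0pos : 0 < D0 := by
    have : 1 / m < 2 / 3 := by rw [div_lt_iff₀ hm0]; linarith
    linarith
  have D0lt : D0 < 2 / 3 := by
    have : 0 < 1 / m := by positivity
    linarith
  have A0 : AA u (1 / (2 / 3 - D0)) := by
    have : 1 / (2 / 3 - D0) = m := by rw [hD0]; simp
    rw [this]; exact hA
  have ind : ∀ n : ℕ, AA u (1 / (2 / 3 - min (1/3) ((3/2)^n * D0))) := by
    intro n
    induction n with
    | zero => exact mono (by simp) D0lt A0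
    | succ k ih =>
      have := boot_step hu hK h (D := min (1/3) ((3/2)^k * D0)) (by positivity) (min_le_left _ _) ih
      refine mono ?_ ?_ this
      · rcases le_total (1/3) ((3/2)^k * D0) with hh | hh
        · rw [min_eq_left hh]
          exact (min_le_left _ _).trans (by norm_num)
        · rw [min_eq_right hh]
          refine (min_le_right _ _).trans (le_of_eq ?_)
          ring
      · have := min_le_left (1/3) ((3/2)^k * D0)
        linarith
  obtain ⟨n, hn⟩ := pow_unbounded_of_one_lt (1 / 3 / D0) (by norm_num : (1:ℝ) < 3/2)
  rw [div_lt_iff₀ D0pos] at hn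
  have A1 := ind n
  rw [min_eq_left hn.le] at A1
  have := boot_step hu hK h (D := 1/3) (by norm_num) le_rfl A1
  norm_num at this
  exact this

lemma u_bdd {u : E3 → E3} {P : E3 → ℝ} (hu : Measurable u)
    (hu_loc : LocallyIntegrable (fun x => ‖u x‖ ^ 2) volume)
    (hweak : IsWeakSolutionNS u P) {m : ℝ} (hm : 3 / 2 < m) (hA : AA u m) (R : ℝ) :
    ∃ M : ℝ, 0 ≤ M ∧ ∀ᵐ x, ‖x‖ < R → ‖u x‖ ≤ M := by
  obtain ⟨C, hC, hpt⟩ := pt2 hu hu_loc hweak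
  obtain ⟨K, hK, hfw⟩ := fw_le hC hpt
  have A6 := boot hu hK hfw hm hA
  set f : E3 → ℝ≥0∞ := (ball (0:E3) (R+2)).indicator (fw u) with hf
  have fm : Measurable f := (fw_meas hu).indicator measurableSet_ball
  set B : ℝ≥0∞ := (∫⁻ z, kk z ^ (6/5 : ℝ)) ^ (1 / (6/5) : ℝ) * (∫⁻ z, f z ^ (6:ℝ)) ^ (1/6 : ℝ) with hB
  have hBt : B ≠ ∞ := by
    refine ENNReal.mul_ne_top ?_ ?_
    · exact (ENNReal.rpow_lt_top_of_nonneg (by norm_num) (kk_pow_int (by norm_num) (by norm_num)).ne).ne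
    · refine (ENNReal.rpow_lt_top_of_nonneg (by norm_num) ?_).ne
      rw [hf, cut_pow hu (by norm_num)]
      exact (A6 _).ne
  have hH : ∀ x ∈ ball (0:E3) R, HH u x ≤ B := by
    intro x hx
    rw [HH_cut hx]
    have := ENNReal.lintegral_mul_le_Lp_mul_Lq (volume : Measure E3) (p := 6/5) (q := 6)
      (by constructor <;> norm_num) (f := fun y => kk (y - x)) (g := f)
      (kk_meas.comp (measurable_id.sub measurable_const)).aemeasurable fm.aemeasurable
    rw [lintegral_sub_right_eq_self (fun z => kk z ^ (6/5 : ℝ)) x] at this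
    exact this
  refine ⟨C * B.toReal, by positivity, ?_⟩
  filter_upwards [hpt] with x hx hxR
  have h1 : ENNReal.ofReal ‖u x‖ ≤ ENNReal.ofReal (C * B.toReal) := by
    rw [ENNReal.ofReal_mul hC, ENNReal.ofReal_toReal hBt]
    refine hx.trans ?_
    gcongr
    exact hH x (by simpa using hxR)
  exact (ENNReal.ofReal_le_ofReal_iff (by positivity)).1 h1


def cv (κ f : E3 → ℝ) (x : E3) : ℝ := ∫ y, κ (x - y) * f y

lemma cv_eq (κ f : E3 → ℝ) : cv κ f = convolution f κ (ContinuousLinearMap.mul ℝ ℝ) volume := by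
  funext x
  rw [convolution_def, cv]
  refine integral_congr_ae (Eventually.of_forall fun y => ?_)
  simp [mul_comm]

lemma cv_smooth {κ f : E3 → ℝ} (hκ : Smooth3 κ) (hc : HasCompactSupport κ)
    (hf : LocallyIntegrable f volume) : Smooth3 (cv κ f) := by
  rw [cv_eq]
  exact hc.contDiff_convolution_right _ hf hκ

lemma pd_cv {κ f : E3 → ℝ} (hκ : Smooth3 κ) (hc : HasCompactSupport κ)
    (hf : LocallyIntegrable f volume) (i : Fin 3) : pd i (cv κ f) = cv (pd i κ) f := by
  funext x
  have h1 : ContDiff ℝ 1 κ := hκ.of_le (by simp)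
  have := hc.hasFDerivAt_convolution_right (ContinuousLinearMap.mul ℝ ℝ) hf h1 x
  rw [cv_eq κ f, pd, this.fderiv, convolution_precompR_apply _ hf (hc.fderiv ℝ)
    (h1.continuous_fderiv (by simp)), cv_eq]
  rfl

lemma mol_eq_cv (n : ℕ) (f : E3 → ℝ) : mol n f = cv (eta n) f := rfl

lemma mol_smooth (n : ℕ) {f : E3 → ℝ} (hf : LocallyIntegrable f volume) : Smooth3 (mol n f) := by
  rw [mol_eq_cv]; exact cv_smooth (eta_smooth n) (eta_cs n) hf

lemma pd_mol (n : ℕ) {f : E3 → ℝ} (hf : LocallyIntegrable f volume) (i : Fin 3) (x : E3) :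
    pd i (mol n f) x = ∫ y, pd i (eta n) (x - y) * f y := by
  rw [mol_eq_cv, pd_cv (eta_smooth n) (eta_cs n) hf]; rfl

lemma shift_smooth {g : E3 → ℝ} (hg : Smooth3 g) (x : E3) : Smooth3 (fun y => g (x - y)) :=
  hg.comp (contDiff_const.sub contDiff_id)

lemma shift_cs {g : E3 → ℝ} (hg : HasCompactSupport g) (x : E3) :
    HasCompactSupport (fun y => g (x - y)) := hg.comp_homeomorph (Homeomorph.subLeft x)

lemma shift_int {g f : E3 → ℝ} (hg : Continuous g) (hc : HasCompactSupport g)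
    (hf : LocallyIntegrable f volume) (x : E3) : Integrable (fun y => g (x - y) * f y) := by
  have := loc_mul_int hf (hg.comp (continuous_const.sub continuous_id)) (shift_cs hc x)
  simpa [mul_comm] using this

lemma lap_mol (n : ℕ) {f : E3 → ℝ} (hf : LocallyIntegrable f volume) (x : E3) :
    lap3 (mol n f) x = ∫ y, lap3 (eta n) (x - y) * f y := by
  have e := eta_smooth n
  have c := eta_cs n
  unfold lap3
  simp_rw [Finset.sum_mul]
  rw [integral_finsetSum _ fun i _ => shift_int ((e.pd i).pd i).continuous ((c.pd' i).pd' i) hf x]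
  refine Finset.sum_congr rfl fun i _ => ?_
  rw [mol_eq_cv, pd_cv e c hf, pd_cv (e.pd i) (c.pd' i) hf]; rfl

lemma mol_div {u : E3 → E3} {P : E3 → ℝ} (hu_meas : Measurable u)
    (hu_loc : LocallyIntegrable (fun x => ‖u x‖ ^ 2) volume)
    (hweak : IsWeakSolutionNS u P) (n : ℕ) (x : E3) :
    ∑ j, pd j (mol n (fun y => u y j)) x = 0 := by
  have e := eta_smooth n
  have c := eta_cs n
  have := hweak.2 (fun y => eta n (x - y)) (shift_smooth e x) (shift_cs c x)
  simp_rw [pd_mol n (loc_ui hu_meas hu_loc _)]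
  rw [← integral_finsetSum _ fun j _ =>
    shift_int (e.pd j).continuous (c.pd' j) (loc_ui hu_meas hu_loc j) x]
  simp_rw [pd_reflect e] at this
  rw [← neg_eq_zero, ← integral_neg, ← this]
  refine integral_congr_ae (Eventually.of_forall fun y => ?_)
  simp only
  rw [← Finset.sum_neg_distrib]
  refine Finset.sum_congr rfl fun j _ => ?_
  ring

def vtest (g : E3 → ℝ) (k : Fin 3) (y : E3) : E3 :=
  WithLp.toLp 2 (fun j => if j = k then g y else 0)

lemma mol_eq {u : E3 → E3} {P : E3 → ℝ} (hu_meas : Measurable u)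
    (hu_loc : LocallyIntegrable (fun x => ‖u x‖ ^ 2) volume) (hP : LocallyIntegrable P volume)
    (hweak : IsWeakSolutionNS u P) (n : ℕ) (k : Fin 3) (x : E3) :
    lap3 (mol n (fun y => u y k)) x - ∑ i, pd i (mol n (fun y => u y i * u y k)) x
      - pd k (mol n P) x = 0 := by
  have e := eta_smooth n
  have c := eta_cs n
  have sg := shift_smooth e x
  set g : E3 → ℝ := fun y => eta n (x - y) with hg
  have hcomp : ∀ j, (fun y => vtest g k y j) = fun y => if j = k then g y else 0 := fun j => rfl
  have hsm : ContDiff ℝ (⊤ : ℕ∞) (vtest g k) := by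
    rw [contDiff_euclidean]
    intro j
    rw [hcomp]
    by_cases h : j = k
    · simp only [h, if_true]; exact sg
    · simp only [h, if_false]; exact contDiff_const
  have hcs : HasCompactSupport (vtest g k) := by
    refine HasCompactSupport.intro (K := tsupport g) (shift_cs c x) fun y hy => ?_
    have : g y = 0 := image_eq_zero_of_notMem_tsupport hy
    ext j
    simp [vtest, this]
  have W := hweak.1 _ hsm hcs
  have p1 : ∀ i j y, pd i (fun y => vtest g k y j) y = if j = k then - pd i (eta n) (x - y) else 0 := by
    intro i j y
    rw [hcomp]
    by_cases h : j = k
    · simp only [h, if_true]; exact pd_reflect e x i y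
    · simp only [h, if_false]; exact pd_zero i y
  have p2 : ∀ j y, lap3 (fun y => vtest g k y j) y = if j = k then lap3 (eta n) (x - y) else 0 := by
    intro j y
    unfold lap3
    have : ∀ i, pd i (fun y => vtest g k y j) = fun y => if j = k then - pd i (eta n) (x - y) else 0 :=
      fun i => funext fun y => p1 i j y
    simp_rw [this]
    by_cases h : j = k
    · simp only [h, if_true]
      refine Finset.sum_congr rfl fun i _ => ?_
      have := pd_const_mul (shift_smooth (e.pd i) x) (-1) i y
      rw [pd_reflect (e.pd i)] at this
      simpa using this
    · simp only [h, if_false]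
      exact Finset.sum_eq_zero fun i _ => pd_zero i y
  simp_rw [p1, p2] at W
  simp only [mul_ite, mul_zero, Finset.sum_ite_eq', Finset.mem_univ, if_true] at W
  rw [lap_mol n (loc_ui hu_meas hu_loc k), pd_mol n hP]
  simp_rw [pd_mol n (loc_uij hu_meas hu_loc _ k)]
  have W2 : ∀ i : Fin 3, ∑ j : Fin 3, ∫ y, (if j = k then u y i * u y j * -pd i (eta n) (x - y) else 0)
      = - ∫ y, pd i (eta n) (x - y) * (u y i * u y k) := by
    intro i
    rw [Finset.sum_eq_single k]
    · simp only [if_true]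
      rw [← integral_neg]
      refine integral_congr_ae (Eventually.of_forall fun y => ?_)
      simp only
      ring
    · intro j _ hj
      simp [hj]
    · simp
  simp_rw [W2] at W
  rw [Finset.sum_neg_distrib] at W
  have W3 : ∫ y, P y * -pd k (eta n) (x - y) = - ∫ y, pd k (eta n) (x - y) * P y := by
    rw [← integral_neg]
    refine integral_congr_ae (Eventually.of_forall fun y => ?_)
    simp only
    ring
  have W4 : ∫ y, u y k * lap3 (eta n) (x - y) = ∫ y, lap3 (eta n) (x - y) * u y k := by
    refine integral_congr_ae (Eventually.of_forall fun y => ?_)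
    simp only
    ring
  rw [W3, W4] at W
  linarith

lemma hasDeriv_pd {g : E3 → ℝ} (hg : Smooth3 g) (i : Fin 3) (x : E3) :
    HasDerivAt (fun t : ℝ => g (x + t • EuclideanSpace.single i 1)) (pd i g x) 0 := by
  have := (hg.diff x).hasFDerivAt.hasLineDerivAt (EuclideanSpace.single i 1)
  exact this

lemma pd_of_deriv {g : E3 → ℝ} (hg : Smooth3 g) {i : Fin 3} {x : E3} {d : ℝ}
    (h : HasDerivAt (fun t : ℝ => g (x + t • EuclideanSpace.single i 1)) d 0) : pd i g x = d :=
  (hasDeriv_pd hg i x).unique h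

def energyRHS (V : Fin 3 → E3 → ℝ) (S : Fin 3 → Fin 3 → E3 → ℝ) (Q χ : E3 → ℝ) (x : E3) : ℝ :=
  (∑ j, 1 / 2 * V j x ^ 2 * lap3 χ x) + (∑ i, ∑ j, 1 / 2 * V j x ^ 2 * (V i x * pd i χ x))
    + (∑ i, Q x * V i x * pd i χ x)
    + ∑ i, ∑ j, (S i j x - V i x * V j x) * (χ x * pd i (V j) x + V j x * pd i χ x)

lemma energy_id {V : Fin 3 → E3 → ℝ} {S : Fin 3 → Fin 3 → E3 → ℝ} {Q χ : E3 → ℝ}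
    (hV : ∀ j, Smooth3 (V j)) (hS : ∀ i j, Smooth3 (S i j)) (hQ : Smooth3 Q) (hχ : Smooth3 χ)
    (hc : HasCompactSupport χ) (hdiv : ∀ x, ∑ j, pd j (V j) x = 0)
    (heq : ∀ k x, lap3 (V k) x - ∑ i, pd i (S i k) x - pd k Q x = 0) :
    ∫ x, χ x * (∑ i, ∑ j, pd i (V j) x ^ 2) = ∫ x, energyRHS V S Q χ x := by
  set Y : Fin 3 → Fin 3 → E3 → ℝ := fun i j x =>
    χ x * V j x * pd i (V j) x - 1 / 2 * (V j x * V j x) * pd i χ x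
      - 1 / 2 * (χ x * V i x) * (V j x * V j x) - χ x * V j x * (S i j x - V i x * V j x) with hY
  set Z : Fin 3 → E3 → ℝ := fun i x => χ x * V i x * Q x with hZ
  have sY : ∀ i j, Smooth3 (Y i j) := by
    intro i j
    have h1 := hV j
    have h2 := hV i
    have h3 := (hV j).pd i
    have h4 := hχ.pd i
    have h5 := hS i j
    simp only [hY]
    unfold Smooth3 at *
    fun_prop
  have sZ : ∀ i, Smooth3 (Z i) := by
    intro i
    have h2 := hV i
    simp only [hZ]
    unfold Smooth3 at *
    fun_prop
  have cY : ∀ i j, HasCompactSupport (Y i j) := by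
    intro i j
    refine HasCompactSupport.intro (K := tsupport χ) hc fun x hx => ?_
    have e1 : χ x = 0 := image_eq_zero_of_notMem_tsupport hx
    have e2 : pd i χ x = 0 := image_eq_zero_of_notMem_tsupport fun h => hx (pd_tsupport χ i h)
    simp [hY, e1, e2]
  have cZ : ∀ i, HasCompactSupport (Z i) := by
    intro i
    refine HasCompactSupport.intro (K := tsupport χ) hc fun x hx => ?_
    have e1 : χ x = 0 := image_eq_zero_of_notMem_tsupport hx
    simp [hZ, e1]
  have dY : ∀ i j x, pd i (Y i j) x =
      pd i χ x * V j x * pd i (V j) x + χ x * pd i (V j) x ^ 2 + χ x * V j x * pd i (pd i (V j)) x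
      - V j x * pd i (V j) x * pd i χ x - 1 / 2 * V j x ^ 2 * pd i (pd i χ) x
      - 1 / 2 * (pd i χ x * V i x + χ x * pd i (V i) x) * V j x ^ 2 - χ x * V i x * V j x * pd i (V j) x
      - (pd i χ x * V j x + χ x * pd i (V j) x) * (S i j x - V i x * V j x)
      - χ x * V j x * (pd i (S i j) x - pd i (V i) x * V j x - V i x * pd i (V j) x) := by
    intro i j x
    have a1 := hasDeriv_pd hχ i x
    have a2 := hasDeriv_pd (hV j) i x
    have a3 := hasDeriv_pd (hV i) i x
    have a4 := hasDeriv_pd ((hV j).pd i) i x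
    have a5 := hasDeriv_pd (hχ.pd i) i x
    have a6 := hasDeriv_pd (hS i j) i x
    have := ((((a1.mul a2).mul a4).sub (((a2.mul a2).const_mul (1/2)).mul a5)).sub
      (((a1.mul a3).const_mul (1/2)).mul (a2.mul a2))).sub ((a1.mul a2).mul (a6.sub (a3.mul a2)))
    refine (pd_of_deriv (sY i j) this).trans ?_
    simp
    ring
  have dZ : ∀ i x, pd i (Z i) x = pd i χ x * V i x * Q x + χ x * pd i (V i) x * Q x
      + χ x * V i x * pd i Q x := by
    intro i x
    have a1 := hasDeriv_pd hχ i x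
    have a3 := hasDeriv_pd (hV i) i x
    have a6 := hasDeriv_pd hQ i x
    refine (pd_of_deriv (sZ i) ((a1.mul a3).mul a6)).trans ?_
    simp
    ring
  have I0 : ∫ x, ((∑ i, ∑ j, pd i (Y i j) x) - ∑ i, pd i (Z i) x) = 0 := by
    have iY : ∀ i j, Integrable (pd i (Y i j)) := fun i j => ((sY i j).pd i).integrable ((cY i j).pd' i)
    have iZ : ∀ i, Integrable (pd i (Z i)) := fun i => ((sZ i).pd i).integrable ((cZ i).pd' i)
    rw [integral_sub (integrable_finsetSum _ fun i _ => integrable_finsetSum _ fun j _ => iY i j)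
      (integrable_finsetSum _ fun i _ => iZ i),
      integral_finsetSum _ fun i _ => integrable_finsetSum _ fun j _ => iY i j,
      integral_finsetSum _ fun i _ => iZ i]
    simp_rw [integral_finsetSum _ fun j _ => iY _ j]
    simp_rw [integral_pd_eq_zero (sY _ _) (cY _ _), integral_pd_eq_zero (sZ _) (cZ _)]
    simp
  have id : ∀ x, (∑ i, ∑ j, pd i (Y i j) x) - ∑ i, pd i (Z i) x =
      χ x * (∑ i, ∑ j, pd i (V j) x ^ 2) - energyRHS V S Q χ x := by
    intro x
    have q0 := heq 0 x
    have q1 := heq 1 x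
    have q2 := heq 2 x
    have d := hdiv x
    simp only [dY, dZ, energyRHS, lap3, Fin.sum_univ_three] at q0 q1 q2 d ⊢
    linear_combination χ x * V 0 x * q0 + χ x * V 1 x * q1 + χ x * V 2 x * q2 +
      (χ x * (1 / 2) * (V 0 x ^ 2 + V 1 x ^ 2 + V 2 x ^ 2) - χ x * Q x) * d
  simp_rw [id] at I0
  have c1 : Integrable fun x => χ x * (∑ i, ∑ j, pd i (V j) x ^ 2) := by
    refine Smooth3.integrable ?_ hc.mul_right
    have : ∀ i j, Smooth3 (pd i (V j)) := fun i j => (hV j).pd i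
    unfold Smooth3 at *
    exact hχ.mul (ContDiff.sum fun i _ => ContDiff.sum fun j _ => (this i j).pow 2)
  have c2 : Integrable (energyRHS V S Q χ) := by
    have h : energyRHS V S Q χ = fun x => χ x * (∑ i, ∑ j, pd i (V j) x ^ 2) -
        ((∑ i, ∑ j, pd i (Y i j) x) - ∑ i, pd i (Z i) x) := by
      funext x; rw [id]; ring
    rw [h]
    exact c1.sub ((integrable_finsetSum _ fun i _ => integrable_finsetSum _ fun j _ =>
      ((sY i j).pd i).integrable ((cY i j).pd' i)).sub
      (integrable_finsetSum _ fun i _ => ((sZ i).pd i).integrable ((cZ i).pd' i)))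
  rw [integral_sub c1 c2] at I0
  linarith


lemma pd_eq_zero_of_open {g : E3 → ℝ} {U : Set E3} (hU : IsOpen U) {c : ℝ}
    (h : ∀ y ∈ U, g y = c) {x : E3} (hx : x ∈ U) (i : Fin 3) : pd i g x = 0 := by
  have : g =ᶠ[𝓝 x] fun _ => c := by
    filter_upwards [hU.mem_nhds hx] with y hy using h y hy
  rw [pd_congr_nhds this]
  simp [pd]

lemma lap_eq_zero_of_open {g : E3 → ℝ} {U : Set E3} (hU : IsOpen U) {c : ℝ}
    (h : ∀ y ∈ U, g y = c) {x : E3} (hx : x ∈ U) : lap3 g x = 0 :=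
  Finset.sum_eq_zero fun i _ =>
    pd_eq_zero_of_open hU (fun _ hy => pd_eq_zero_of_open hU h hy i) hx i

def chi0 (z : E3) : ℝ := th 0 (‖z‖ ^ 2)
def chi (R : ℝ) (x : E3) : ℝ := chi0 (R⁻¹ • x)

lemma chi0_smooth : Smooth3 chi0 := by
  have h : chi0 = fun z : E3 => (fun t => Real.smoothTransition (3 - t)) (‖z‖ ^ 2) := by
    funext z; simp [chi0, th_zero_eq]
  rw [h]
  exact th_smooth.comp (contDiff_norm_sq ℝ)

lemma chi0_far {z : E3} (hz : 2 ≤ ‖z‖) : chi0 z = 0 := th_far (by nlinarith) 0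

lemma chi0_cs : HasCompactSupport chi0 := by
  refine HasCompactSupport.intro (isCompact_closedBall (0:E3) 2) fun x hx => chi0_far ?_
  have : 2 < ‖x‖ := by simpa using hx
  exact this.le

lemma chi_smooth (R : ℝ) : Smooth3 (chi R) :=
  chi0_smooth.comp (contDiff_const_smul R⁻¹)

lemma chi_one {R : ℝ} (hR : 0 < R) {x : E3} (hx : ‖x‖ ≤ R) : chi R x = 1 := by
  refine th_one ?_
  rw [norm_smul, Real.norm_of_nonneg (by positivity)]
  have : R⁻¹ * ‖x‖ ≤ 1 := by rw [inv_mul_le_iff₀ hR]; linarith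
  have : 0 ≤ R⁻¹ * ‖x‖ := by positivity
  nlinarith

lemma chi_far {R : ℝ} (hR : 0 < R) {x : E3} (hx : 2 * R ≤ ‖x‖) : chi R x = 0 := by
  refine chi0_far ?_
  rw [norm_smul, Real.norm_of_nonneg (by positivity), le_inv_mul_iff₀ hR]
  linarith

lemma chi_cs {R : ℝ} (hR : 0 < R) : HasCompactSupport (chi R) := by
  refine HasCompactSupport.intro (isCompact_closedBall (0:E3) (2 * R)) fun x hx => chi_far hR ?_
  have : 2 * R < ‖x‖ := by simpa using hx
  exact this.le

lemma chi_nonneg (R : ℝ) (x : E3) : 0 ≤ chi R x := by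
  unfold chi chi0; rw [th_zero_eq]; exact Real.smoothTransition.nonneg _

lemma chi_le (R : ℝ) (x : E3) : chi R x ≤ 1 := by
  unfold chi chi0; rw [th_zero_eq]; exact Real.smoothTransition.le_one _

lemma chi_bounds : ∃ C : ℝ, 0 ≤ C ∧ ∀ R : ℝ, 0 < R → ∀ x,
    (∀ i, |pd i (chi R) x| ≤ C * R⁻¹) ∧ |lap3 (chi R) x| ≤ C * R⁻¹ ^ 2 := by
  have h1 : ∀ i, ∃ C, ∀ x, ‖pd i chi0 x‖ ≤ C := fun i =>
    (chi0_smooth.pd i).continuous.bounded_above_of_compact_support (chi0_cs.pd' i)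
  obtain ⟨C2, h2⟩ := chi0_smooth.lap.continuous.bounded_above_of_compact_support chi0_cs.lap'
  choose C hC using h1
  have n1 : ∀ i, 0 ≤ C i := fun i => (norm_nonneg _).trans (hC i 0)
  have n2 : 0 ≤ C2 := (norm_nonneg _).trans (h2 0)
  refine ⟨(∑ i, C i) + C2, add_nonneg (Finset.sum_nonneg fun i _ => n1 i) n2, fun R hR x => ?_⟩
  have hi : 0 < R⁻¹ := by positivity
  constructor
  · intro i
    have : pd i (chi R) x = R⁻¹ * pd i chi0 (R⁻¹ • x) := pd_scale chi0_smooth _ i x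
    rw [this, abs_mul, abs_of_pos hi, mul_comm]
    refine mul_le_mul_of_nonneg_right ?_ hi.le
    have a := hC i (R⁻¹ • x)
    have b := Finset.single_le_sum (f := C) (fun i _ => n1 i) (Finset.mem_univ i)
    rw [Real.norm_eq_abs] at a
    linarith
  · have : lap3 (chi R) x = R⁻¹ ^ 2 * lap3 chi0 (R⁻¹ • x) := by
      unfold lap3
      rw [Finset.mul_sum]
      refine Finset.sum_congr rfl fun i _ => ?_
      have e : pd i (chi R) = fun x => R⁻¹ * pd i chi0 (R⁻¹ • x) :=
        funext fun x => pd_scale chi0_smooth _ i x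
      rw [e, pd_const_mul (f := fun x => pd i chi0 (R⁻¹ • x))
        ((chi0_smooth.pd i).comp (contDiff_const_smul R⁻¹)),
        pd_scale (chi0_smooth.pd i)]
      ring
    rw [this, abs_mul, abs_of_pos (by positivity), mul_comm]
    refine mul_le_mul_of_nonneg_right ?_ (by positivity)
    have a := h2 (R⁻¹ • x)
    have b := Finset.sum_nonneg fun i (_ : i ∈ Finset.univ) => n1 i
    rw [Real.norm_eq_abs] at a
    linarith

def ann (R : ℝ) : Set E3 := {x | R ≤ ‖x‖ ∧ ‖x‖ ≤ 2 * R}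

lemma ann_closed (R : ℝ) : IsClosed (ann R) :=
  (isClosed_le continuous_const continuous_norm).inter (isClosed_le continuous_norm continuous_const)

lemma chi_off {R : ℝ} (hR : 0 < R) {x : E3} (hx : x ∉ ann R) :
    (∀ i, pd i (chi R) x = 0) ∧ lap3 (chi R) x = 0 := by
  by_cases h : ‖x‖ < R
  · have hU : IsOpen {x : E3 | ‖x‖ < R} := isOpen_lt continuous_norm continuous_const
    have hc : ∀ y ∈ {x : E3 | ‖x‖ < R}, chi R y = 1 := fun y hy => chi_one hR (le_of_lt hy)
    exact ⟨fun i => pd_eq_zero_of_open hU hc h i, lap_eq_zero_of_open hU hc h⟩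
  · have h2 : 2 * R < ‖x‖ := by
      by_contra h3
      exact hx ⟨not_lt.1 h, not_lt.1 h3⟩
    have hU : IsOpen {x : E3 | 2 * R < ‖x‖} := isOpen_lt continuous_const continuous_norm
    have hc : ∀ y ∈ {x : E3 | 2 * R < ‖x‖}, chi R y = 0 := fun y hy => chi_far hR (le_of_lt hy)
    exact ⟨fun i => pd_eq_zero_of_open hU hc h2 i, lap_eq_zero_of_open hU hc h2⟩

lemma young_sq {a b : ℝ} (ha : 0 ≤ a) (hb : 0 ≤ b) : a ^ 2 * b ≤ a ^ 3 + b ^ 3 := by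
  rcases le_total a b with h | h
  · have : a ^ 2 * b ≤ b ^ 2 * b := by gcongr
    have := pow_nonneg ha 3
    nlinarith
  · have : a ^ 2 * b ≤ a ^ 2 * a := by gcongr
    have := pow_nonneg hb 3
    nlinarith

lemma main_terms {V X : Fin 3 → ℝ} {q L b c : ℝ} (hb : 0 ≤ b) (hc : 0 ≤ c)
    (hX : ∀ i, |X i| ≤ c * b) (hL : |L| ≤ c * b ^ 2) :
    (∑ j, 1 / 2 * V j ^ 2 * L) + (∑ i, ∑ j, 1 / 2 * V j ^ 2 * (V i * X i)) + (∑ i, q * V i * X i)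
      ≤ 27 * c * b * ((∑ j, |V j| ^ 3) + √|q| ^ 3 + b ^ 3) := by
  set w := √|q| with hw
  have hw0 : 0 ≤ w := Real.sqrt_nonneg _
  have hwq : w ^ 2 = |q| := Real.sq_sqrt (abs_nonneg _)
  set v := ∑ j, |V j| with hv
  have hv0 : 0 ≤ v := Finset.sum_nonneg fun _ _ => abs_nonneg _
  set s := ∑ j, V j ^ 2 with hs
  have hs0 : 0 ≤ s := Finset.sum_nonneg fun _ _ => sq_nonneg _
  have hsv : s ≤ v ^ 2 := by
    have := Finset.sum_sq_le_sq_sum_of_nonneg (s := Finset.univ) (f := fun j => |V j|) fun _ _ => abs_nonneg _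
    simpa [sq_abs] using this
  have hX' : ∑ i, V i * X i ≤ v * (c * b) := by
    rw [hv, Finset.sum_mul]
    refine Finset.sum_le_sum fun i _ => (le_abs_self _).trans ?_
    rw [abs_mul]
    exact mul_le_mul_of_nonneg_left (hX i) (abs_nonneg _)
  have hX2 : |∑ i, V i * X i| ≤ v * (c * b) := by
    rw [hv, Finset.sum_mul]
    refine (Finset.abs_sum_le_sum_abs _ _).trans (Finset.sum_le_sum fun i _ => ?_)
    rw [abs_mul]
    exact mul_le_mul_of_nonneg_left (hX i) (abs_nonneg _)
  have t1 : (∑ j, 1 / 2 * V j ^ 2 * L) ≤ v ^ 2 * (c * b ^ 2) := by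
    have : (∑ j, 1 / 2 * V j ^ 2 * L) = 1 / 2 * s * L := by
      rw [hs, Finset.mul_sum, Finset.sum_mul]
    rw [this]
    have h1 : 1 / 2 * s * L ≤ 1 / 2 * s * (c * b ^ 2) :=
      mul_le_mul_of_nonneg_left ((le_abs_self _).trans hL) (by positivity)
    have h2 : s * (c * b ^ 2) ≤ v ^ 2 * (c * b ^ 2) := by gcongr
    have h3 : 0 ≤ s * (c * b ^ 2) := by positivity
    linarith
  have t2 : (∑ i, ∑ j, 1 / 2 * V j ^ 2 * (V i * X i)) ≤ v ^ 3 * (c * b) := by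
    have : (∑ i, ∑ j, 1 / 2 * V j ^ 2 * (V i * X i)) = 1 / 2 * s * ∑ i, V i * X i := by
      simp only [hs, Fin.sum_univ_three]; ring
    rw [this]
    have h1 : 1 / 2 * s * (∑ i, V i * X i) ≤ 1 / 2 * s * (v * (c * b)) :=
      mul_le_mul_of_nonneg_left hX' (by positivity)
    have h2 : s * (v * (c * b)) ≤ v ^ 2 * (v * (c * b)) := by gcongr
    have h3 : 0 ≤ s * (v * (c * b)) := by positivity
    nlinarith
  have t3 : (∑ i, q * V i * X i) ≤ w ^ 2 * (v * (c * b)) := by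
    have : (∑ i, q * V i * X i) = q * ∑ i, V i * X i := by
      rw [Finset.mul_sum]; exact Finset.sum_congr rfl fun i _ => by ring
    rw [this, hwq]
    refine (le_abs_self _).trans ?_
    rw [abs_mul]
    exact mul_le_mul_of_nonneg_left hX2 (abs_nonneg _)
  have y1 := young_sq hv0 hb
  have y2 := young_sq hw0 hv0
  have hv3 : v ^ 3 ≤ 9 * ∑ j, |V j| ^ 3 := by
    have := Real.pow_arith_mean_le_arith_mean_pow Finset.univ (fun _ : Fin 3 => (1/3 : ℝ)) (fun j => |V j|)
      (fun _ _ => by norm_num) (by simp) (fun _ _ => abs_nonneg _) 3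
    rw [← Finset.mul_sum, ← Finset.mul_sum, ← hv, mul_pow] at this
    linarith
  have S0 : 0 ≤ ∑ j, |V j| ^ 3 := Finset.sum_nonneg fun _ _ => by positivity
  have : v ^ 2 * b + v ^ 3 + w ^ 2 * v ≤ 27 * ((∑ j, |V j| ^ 3) + w ^ 3 + b ^ 3) := by
    have := pow_nonneg hw0 3
    have := pow_nonneg hb 3
    linarith
  have hcb : 0 ≤ c * b := by positivity
  have := mul_le_mul_of_nonneg_left this hcb
  nlinarith


def Phi (C R : ℝ) (V : Fin 3 → E3 → ℝ) (Q : E3 → ℝ) (x : E3) : ℝ :=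
  (ann R).indicator (fun x => 27 * C * R⁻¹ * ((∑ j, |V j x| ^ 3) + √|Q x| ^ 3 + R⁻¹ ^ 3)) x

def Psi (R : ℝ) (V : Fin 3 → E3 → ℝ) (S : Fin 3 → Fin 3 → E3 → ℝ) (x : E3) : ℝ :=
  ∑ i, ∑ j, (1 / 2 * chi R x * (S i j x - V i x * V j x) ^ 2
    + |S i j x - V i x * V j x| * |V j x| * |pd i (chi R) x|)

lemma off_tsupport {χ : E3 → ℝ} {x : E3} (hx : x ∉ tsupport χ) :
    χ x = 0 ∧ (∀ i, pd i χ x = 0) ∧ lap3 χ x = 0 := by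
  have hU : IsOpen (tsupport χ)ᶜ := (isClosed_tsupport χ).isOpen_compl
  have h0 : ∀ y ∈ (tsupport χ)ᶜ, χ y = 0 := fun y hy => image_eq_zero_of_notMem_tsupport hy
  exact ⟨h0 x hx, fun i => pd_eq_zero_of_open hU h0 hx i, lap_eq_zero_of_open hU h0 hx⟩

lemma energyRHS_int {V : Fin 3 → E3 → ℝ} {S : Fin 3 → Fin 3 → E3 → ℝ} {Q χ : E3 → ℝ}
    (hV : ∀ j, Smooth3 (V j)) (hS : ∀ i j, Smooth3 (S i j)) (hQ : Smooth3 Q) (hχ : Smooth3 χ)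
    (hc : HasCompactSupport χ) : Integrable (energyRHS V S Q χ) := by
  have a1 := fun j => (hV j).continuous
  have a2 := fun i j => (hS i j).continuous
  have a3 := hQ.continuous
  have a4 := hχ.continuous
  have a5 := fun i => (hχ.pd i).continuous
  have a6 := hχ.lap.continuous
  have a7 := fun i j => ((hV j).pd i).continuous
  refine Continuous.integrable_of_hasCompactSupport ?_ ?_
  · unfold energyRHS; fun_prop
  · refine HasCompactSupport.intro hc fun x hx => ?_
    obtain ⟨b1, b2, b3⟩ := off_tsupport hx
    simp [energyRHS, b1, b2, b3]

lemma Psi_int {R : ℝ} (hR : 0 < R) {V : Fin 3 → E3 → ℝ} {S : Fin 3 → Fin 3 → E3 → ℝ} 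
    (hV : ∀ j, Smooth3 (V j)) (hS : ∀ i j, Smooth3 (S i j)) : Integrable (Psi R V S) := by
  have a1 := fun j => (hV j).continuous
  have a2 := fun i j => (hS i j).continuous
  have a4 := (chi_smooth R).continuous
  have a5 := fun i => ((chi_smooth R).pd i).continuous
  refine Continuous.integrable_of_hasCompactSupport ?_ ?_
  · unfold Psi; fun_prop
  · refine HasCompactSupport.intro (chi_cs hR) fun x hx => ?_
    obtain ⟨b1, b2, b3⟩ := off_tsupport hx
    simp [Psi, b1, b2]

lemma ann_compact (R : ℝ) : IsCompact (ann R) :=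
  (isCompact_closedBall (0:E3) (2 * R)).of_isClosed_subset (ann_closed R) fun x hx => by
    simpa using hx.2

lemma Phi_int {C R : ℝ} {V : Fin 3 → E3 → ℝ} {Q : E3 → ℝ}
    (hV : ∀ j, Smooth3 (V j)) (hQ : Smooth3 Q) : Integrable (Phi C R V Q) := by
  have a1 := fun j => (hV j).continuous
  have a3 := hQ.continuous
  refine (IntegrableOn.integrable_indicator ?_ (ann_closed R).measurableSet)
  refine ContinuousOn.integrableOn_compact (ann_compact R) (Continuous.continuousOn ?_)
  fun_prop

lemma grad_int {R : ℝ} (hR : 0 < R) {V : Fin 3 → E3 → ℝ} (hV : ∀ j, Smooth3 (V j)) :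
    Integrable (fun x => chi R x * (∑ i, ∑ j, pd i (V j) x ^ 2)) := by
  have a4 := (chi_smooth R).continuous
  have a7 := fun i j => ((hV j).pd i).continuous
  refine Continuous.integrable_of_hasCompactSupport (by fun_prop) (chi_cs hR).mul_right

lemma energy_ineq {C R : ℝ} (hR : 0 < R) (hC0 : 0 ≤ C)
    (hC : ∀ x, (∀ i, |pd i (chi R) x| ≤ C * R⁻¹) ∧ |lap3 (chi R) x| ≤ C * R⁻¹ ^ 2)
    {V : Fin 3 → E3 → ℝ} {S : Fin 3 → Fin 3 → E3 → ℝ} {Q : E3 → ℝ}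
    (hV : ∀ j, Smooth3 (V j)) (hS : ∀ i j, Smooth3 (S i j)) (hQ : Smooth3 Q)
    (hdiv : ∀ x, ∑ j, pd j (V j) x = 0)
    (heq : ∀ k x, lap3 (V k) x - ∑ i, pd i (S i k) x - pd k Q x = 0) :
    1 / 2 * ∫ x, chi R x * (∑ i, ∑ j, pd i (V j) x ^ 2) ≤
      (∫ x, Phi C R V Q x) + ∫ x, Psi R V S x := by
  have e := energy_id hV hS hQ (chi_smooth R) (chi_cs hR) hdiv heq
  have i1 := energyRHS_int hV hS hQ (chi_smooth R) (chi_cs hR)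
  have i2 := grad_int hR hV
  have i3 := Phi_int (C := C) (R := R) hV hQ
  have i4 := Psi_int hR hV hS
  have key : ∀ x, energyRHS V S Q (chi R) x ≤
      1 / 2 * (chi R x * (∑ i, ∑ j, pd i (V j) x ^ 2)) + (Phi C R V Q x + Psi R V S x) := by
    intro x
    have h1 : (∑ j, 1 / 2 * V j x ^ 2 * lap3 (chi R) x)
        + (∑ i, ∑ j, 1 / 2 * V j x ^ 2 * (V i x * pd i (chi R) x))
        + (∑ i, Q x * V i x * pd i (chi R) x) ≤ Phi C R V Q x := by
      by_cases hx : x ∈ ann R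
      · rw [Phi, Set.indicator_of_mem hx]
        exact main_terms (V := fun j => V j x) (X := fun i => pd i (chi R) x) (by positivity) hC0
          (hC x).1 (hC x).2
      · rw [Phi, Set.indicator_of_notMem hx]
        obtain ⟨b1, b2⟩ := chi_off hR hx
        simp [b1, b2]
    have h2 : ∑ i, ∑ j, (S i j x - V i x * V j x) *
          (chi R x * pd i (V j) x + V j x * pd i (chi R) x) ≤
        1 / 2 * (chi R x * (∑ i, ∑ j, pd i (V j) x ^ 2)) + Psi R V S x := by
      rw [Psi, Finset.mul_sum, Finset.mul_sum, ← Finset.sum_add_distrib]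
      refine Finset.sum_le_sum fun i _ => ?_
      rw [Finset.mul_sum, Finset.mul_sum, ← Finset.sum_add_distrib]
      refine Finset.sum_le_sum fun j _ => ?_
      set r := S i j x - V i x * V j x
      have c0 := chi_nonneg R x
      have c1 : r * (V j x * pd i (chi R) x) ≤ |r| * |V j x| * |pd i (chi R) x| := by
        rw [← abs_mul, ← abs_mul, mul_assoc]; exact le_abs_self _
      have c2 := mul_nonneg c0 (sq_nonneg (r - pd i (V j) x))
      nlinarith
    unfold energyRHS
    linarith
  have := integral_mono i1 ((i2.const_mul (1/2)).add (i3.add i4)) key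
  rw [integral_add' (i2.const_mul (1/2)) (i3.add i4), integral_add' i3 i4, ← e, integral_const_mul] at this
  linarith


lemma jensenE {w h : E3 → ℝ≥0∞} (hw : Measurable w) (hh : Measurable h) (h1 : ∫⁻ y, w y = 1)
    {m : ℝ} (hm : 1 ≤ m) : (∫⁻ y, w y * h y) ^ m ≤ ∫⁻ y, w y * h y ^ m := by
  have m0 : 0 < m := by linarith
  have mi : m⁻¹ ≤ 1 := inv_le_one_of_one_le₀ hm
  have key := ENNReal.lintegral_mul_norm_pow_le (μ := (volume : Measure E3))
    (f := fun y => w y * h y ^ m) (g := w) (by fun_prop) hw.aemeasurable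
    (p := m⁻¹) (q := 1 - m⁻¹) (by positivity) (by linarith) (by ring)
  have e : ∀ y, (w y * h y ^ m) ^ m⁻¹ * w y ^ (1 - m⁻¹) = w y * h y := by
    intro y
    rw [ENNReal.mul_rpow_of_nonneg _ _ (by positivity), ← ENNReal.rpow_mul, mul_inv_cancel₀ m0.ne',
      ENNReal.rpow_one, mul_right_comm, ← ENNReal.rpow_add_of_nonneg _ _ (by positivity) (by linarith)]
    simp
  simp only [e, h1, ENNReal.one_rpow, mul_one] at key
  calc (∫⁻ y, w y * h y) ^ m ≤ ((∫⁻ y, w y * h y ^ m) ^ m⁻¹) ^ m := ENNReal.rpow_le_rpow key m0.le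
    _ = _ := by rw [← ENNReal.rpow_mul, inv_mul_cancel₀ m0.ne', ENNReal.rpow_one]

lemma etaE_one (n : ℕ) (x : E3) : ∫⁻ y, ENNReal.ofReal (eta n (x - y)) = 1 := by
  have : ∫⁻ y, ENNReal.ofReal (eta n (x - y)) = ∫⁻ y, ENNReal.ofReal (eta n y) :=
    lintegral_sub_left_eq_self (fun z => ENNReal.ofReal (eta n z)) x
  rw [this, ← ofReal_integral_eq_lintegral_ofReal ((eta_smooth n).integrable (eta_cs n))
    (Eventually.of_forall (eta_nonneg n)), eta_one]
  simp

lemma mol_leE (n : ℕ) (f : E3 → ℝ) (x : E3) :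
    ENNReal.ofReal |mol n f x| ≤ ∫⁻ y, ENNReal.ofReal (eta n (x - y)) * ENNReal.ofReal |f y| := by
  rw [← Real.norm_eq_abs, ofReal_norm, mol]
  refine (enorm_integral_le_lintegral_enorm _).trans (le_of_eq (lintegral_congr fun y => ?_))
  rw [← ofReal_norm, norm_mul, Real.norm_of_nonneg (eta_nonneg n _), ENNReal.ofReal_mul (eta_nonneg n _),
    Real.norm_eq_abs]

lemma eta_meas (n : ℕ) : Measurable (eta n) := (eta_smooth n).continuous.measurable

lemma mol_jensen (n : ℕ) {f : E3 → ℝ} (hf : Measurable f) (x : E3) {m : ℝ} (hm : 1 ≤ m) :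
    ENNReal.ofReal |mol n f x| ^ m ≤
      ∫⁻ y, ENNReal.ofReal (eta n (x - y)) * ENNReal.ofReal |f y| ^ m := by
  have := eta_meas n
  refine (ENNReal.rpow_le_rpow (mol_leE n f x) (by linarith)).trans
    (jensenE (by fun_prop) (by fun_prop) (etaE_one n x) hm)

def annp (R : ℝ) : Set E3 := {x | R / 2 ≤ ‖x‖ ∧ ‖x‖ ≤ 3 * R}

lemma annp_closed (R : ℝ) : IsClosed (annp R) :=
  (isClosed_le continuous_const continuous_norm).inter (isClosed_le continuous_norm continuous_const)

lemma fub (n : ℕ) {R : ℝ} (hR : 2 ≤ R) {g : E3 → ℝ≥0∞} (hg : Measurable g) :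
    ∫⁻ x in ann R, ∫⁻ y, ENNReal.ofReal (eta n (x - y)) * g y ≤ ∫⁻ y in annp R, g y := by
  have := eta_meas n
  rw [lintegral_lintegral_swap (by fun_prop), ← lintegral_indicator (annp_closed R).measurableSet]
  refine lintegral_mono fun y => ?_
  by_cases hy : y ∈ annp R
  · rw [Set.indicator_of_mem hy, lintegral_mul_const _ (by fun_prop)]
    have : ∫⁻ x in ann R, ENNReal.ofReal (eta n (x - y)) ≤ 1 := by
      refine (setLIntegral_le_lintegral _ _).trans (le_of_eq ?_)
      rw [lintegral_sub_right_eq_self (fun z => ENNReal.ofReal (eta n z)) y]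
      have := etaE_one n 0
      rw [← ofReal_integral_eq_lintegral_ofReal ((eta_smooth n).integrable (eta_cs n))
        (Eventually.of_forall (eta_nonneg n)), eta_one]
      simp
    exact mul_le_of_le_one_left zero_le this
  · rw [Set.indicator_of_notMem hy]
    refine le_of_eq ((setLIntegral_congr_fun (g := 0) (ann_closed R).measurableSet fun x hx => ?_).trans (by simp))
    have : eta n (x - y) = 0 := by
      refine eta_far n (le_trans (b := 1) ?_ ?_)
      · rw [div_le_one (by positivity)]; linarith [Nat.cast_nonneg (α := ℝ) n]
      · by_contra hlt
        have h1 := norm_sub_norm_le x y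
        have h2 := norm_sub_norm_le y x
        rw [norm_sub_rev] at h2
        exact hy ⟨by linarith [hx.1], by linarith [hx.2]⟩
    simp [this]

lemma sqrt_cube (a : ℝ) : ENNReal.ofReal (√|a|) ^ 3 = ENNReal.ofReal |a| ^ (3/2 : ℝ) := by
  rw [← ENNReal.ofReal_pow (Real.sqrt_nonneg _), ENNReal.ofReal_rpow_of_nonneg (abs_nonneg _) (by norm_num),
    Real.sqrt_eq_rpow, ← Real.rpow_natCast, ← Real.rpow_mul (abs_nonneg _)]
  norm_num

def Tail (C R : ℝ) (u : E3 → E3) (P : E3 → ℝ) : ℝ≥0∞ :=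
  ENNReal.ofReal (27 * C * R⁻¹) * ((∑ j, ∫⁻ x in annp R, ENNReal.ofReal |u x j| ^ 3)
    + (∫⁻ x in annp R, ENNReal.ofReal (√|P x|) ^ 3) + ENNReal.ofReal (R⁻¹ ^ 3) * volume (annp R))

lemma Phi_le (n : ℕ) {C R : ℝ} (hC : 0 ≤ C) (hR : 2 ≤ R) {u : E3 → E3} {P : E3 → ℝ}
    (hu_meas : Measurable u)
    (hu_loc : LocallyIntegrable (fun x => ‖u x‖ ^ 2) volume) (hPm : Measurable P) 
    (hP : LocallyIntegrable P volume) :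
    ENNReal.ofReal (∫ x, Phi C R (fun j => mol n (fun y => u y j)) (mol n P) x) ≤ Tail C R u P := by
  have hV : ∀ j, Smooth3 (mol n (fun y => u y j)) := fun j => mol_smooth n (loc_ui hu_meas hu_loc j)
  have hQ := mol_smooth n hP
  have R0 : 0 < R := by linarith
  have cV : ∀ j, Measurable (mol n (fun y => u y j)) := fun j => (hV j).continuous.measurable
  have cQ := hQ.continuous.measurable
  have mj : ∀ j, Measurable (fun x => u x j) := fun j => by fun_prop
  rw [ofReal_integral_eq_lintegral_ofReal (Phi_int hV hQ) (Eventually.of_forall fun x => by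
    refine Set.indicator_nonneg (fun x _ => ?_) x
    have : 0 ≤ ∑ j, |mol n (fun y => u y j) x| ^ 3 := Finset.sum_nonneg fun _ _ => by positivity
    positivity)]
  have e : ∀ x, ENNReal.ofReal (Phi C R (fun j => mol n (fun y => u y j)) (mol n P) x) =
      (ann R).indicator (fun x => ENNReal.ofReal (27 * C * R⁻¹) *
        ((∑ j, ENNReal.ofReal |mol n (fun y => u y j) x| ^ 3) + ENNReal.ofReal (√|mol n P x|) ^ 3
          + ENNReal.ofReal (R⁻¹ ^ 3))) x := by
    intro x
    unfold Phi
    by_cases hx : x ∈ ann R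
    · rw [Set.indicator_of_mem hx, Set.indicator_of_mem hx, ENNReal.ofReal_mul (by positivity),
        ENNReal.ofReal_add (add_nonneg (Finset.sum_nonneg fun _ _ => by positivity) (by positivity))
          (by positivity), ENNReal.ofReal_add (Finset.sum_nonneg fun _ _ => by positivity)
          (by positivity), ENNReal.ofReal_sum_of_nonneg (fun _ _ => by positivity),
        ENNReal.ofReal_pow (Real.sqrt_nonneg _)]
      simp only [ENNReal.ofReal_pow (abs_nonneg _)]
    · rw [Set.indicator_of_notMem hx, Set.indicator_of_notMem hx, ENNReal.ofReal_zero]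
  simp only [e]
  rw [lintegral_indicator (ann_closed R).measurableSet, lintegral_const_mul _ (by fun_prop), Tail]
  refine mul_le_mul_right ?_ _
  rw [lintegral_add_right _ (by fun_prop), lintegral_add_right _ (by fun_prop),
    lintegral_finsetSum _ (fun j _ => by fun_prop), setLIntegral_const]
  refine add_le_add (add_le_add (Finset.sum_le_sum fun j _ => ?_) ?_) (mul_le_mul_right (measure_mono ?_) _)
  · refine le_trans (lintegral_mono fun x => ?_) (fub n hR (g := fun x => ENNReal.ofReal |u x j| ^ 3) (by fun_prop))
    have := mol_jensen n (mj j) x (m := 3) (by norm_num)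
    have e3 : ∀ a : ℝ≥0∞, a ^ (3 : ℝ) = a ^ 3 := fun a => by exact_mod_cast ENNReal.rpow_natCast a 3
    simpa only [e3] using this
  · refine le_trans (lintegral_mono fun x => ?_) (fub n hR (g := fun x => ENNReal.ofReal √|P x| ^ 3) (by fun_prop))
    have := mol_jensen n hPm x (m := 3/2) (by norm_num)
    simpa only [sqrt_cube] using this
  · exact fun x hx => ⟨by linarith [hx.1], by linarith [hx.2]⟩


lemma mol_bdd (n : ℕ) {f : E3 → ℝ} {K r : ℝ} (hK : 0 ≤ K) (h : ∀ᵐ y, ‖y‖ < r + 1 → |f y| ≤ K)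
    {x : E3} (hx : ‖x‖ ≤ r) : |mol n f x| ≤ K := by
  have := eta_meas n
  have h1 : ENNReal.ofReal |mol n f x| ≤ ENNReal.ofReal K := by
    refine (mol_leE n f x).trans ?_
    calc _ ≤ ∫⁻ y, ENNReal.ofReal (eta n (x - y)) * ENNReal.ofReal K := by
          refine lintegral_mono_ae ?_
          filter_upwards [h] with y hy
          by_cases hr : ‖y‖ < r + 1
          · exact mul_le_mul_right (ENNReal.ofReal_le_ofReal (hy hr)) _
          · have : eta n (x - y) = 0 := by
              refine eta_far n (le_trans (b := 1) ?_ ?_)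
              · rw [div_le_one (by positivity)]; linarith [Nat.cast_nonneg (α := ℝ) n]
              · have h2 := norm_sub_norm_le y x
                rw [norm_sub_rev] at h2
                linarith
            simp [this]
      _ = _ := by rw [lintegral_mul_const _ (by fun_prop), etaE_one, one_mul]
  exact (ENNReal.ofReal_le_ofReal_iff hK).1 h1

lemma Psi_tendsto {R : ℝ} (hR : 0 < R) {u : E3 → E3} (hu_meas : Measurable u)
    (hu_loc : LocallyIntegrable (fun x => ‖u x‖ ^ 2) volume) {M : ℝ} (hM : 0 ≤ M)
    (hb : ∀ᵐ x, ‖x‖ < 2 * R + 1 → ‖u x‖ ≤ M) :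
    Tendsto (fun n => ∫ x, Psi R (fun j => mol n (fun y => u y j))
      (fun i j => mol n (fun y => u y i * u y j)) x) atTop (𝓝 0) := by
  obtain ⟨C, hC0, hC⟩ := chi_bounds
  have hV : ∀ n j, Smooth3 (mol n (fun y => u y j)) := fun n j => mol_smooth n (loc_ui hu_meas hu_loc j)
  have hS : ∀ n i j, Smooth3 (mol n (fun y => u y i * u y j)) := fun n i j =>
    mol_smooth n (loc_uij hu_meas hu_loc i j)
  set K : ℝ := 1 / 2 * (2 * M ^ 2) ^ 2 + 2 * M ^ 2 * M * (C * R⁻¹) with hKdef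
  have hK : 0 ≤ K := by positivity
  have h0 : ∫ x : E3, (0 : ℝ) = 0 := by simp
  rw [← h0]
  refine tendsto_integral_of_dominated_convergence
    ((closedBall (0:E3) (2 * R)).indicator fun _ => 9 * K)
    (fun n => (Psi_int hR (hV n) (hS n)).aestronglyMeasurable) ?_ ?_ ?_
  · refine IntegrableOn.integrable_indicator ?_ measurableSet_closedBall
    exact integrableOn_const (measure_closedBall_lt_top).ne
  · intro n
    refine Eventually.of_forall fun x => ?_
    have bV : ∀ j, ‖x‖ ≤ 2 * R → |mol n (fun y => u y j) x| ≤ M := fun j hx => by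
      refine mol_bdd n hM ?_ hx
      filter_upwards [hb] with y hy h
      exact (abs_coord_le _ _).trans (hy h)
    have bS : ∀ i j, ‖x‖ ≤ 2 * R → |mol n (fun y => u y i * u y j) x| ≤ M ^ 2 := fun i j hx => by
      refine mol_bdd n (by positivity) ?_ hx
      filter_upwards [hb] with y hy h
      rw [abs_mul, sq]
      exact mul_le_mul ((abs_coord_le _ _).trans (hy h)) ((abs_coord_le _ _).trans (hy h))
        (abs_nonneg _) hM
    by_cases hx : ‖x‖ ≤ 2 * R
    · rw [Set.indicator_of_mem (by simpa using hx), Real.norm_eq_abs]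
      have ht : ∀ i j : Fin 3, abs (1 / 2 * chi R x * (mol n (fun y => u y i * u y j) x
          - mol n (fun y => u y i) x * mol n (fun y => u y j) x) ^ 2
          + |mol n (fun y => u y i * u y j) x - mol n (fun y => u y i) x * mol n (fun y => u y j) x|
            * |mol n (fun y => u y j) x| * |pd i (chi R) x|) ≤ K := by
        intro i j
        set r := mol n (fun y => u y i * u y j) x - mol n (fun y => u y i) x * mol n (fun y => u y j) x
          with hr
        have hrb : |r| ≤ 2 * M ^ 2 := by
          have a := abs_sub (mol n (fun y => u y i * u y j) x)
            (mol n (fun y => u y i) x * mol n (fun y => u y j) x)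
          rw [abs_mul] at a
          have b := mul_le_mul (bV i hx) (bV j hx) (abs_nonneg _) hM
          have c := bS i j hx
          rw [hr]; nlinarith
        have c0 := chi_nonneg R x
        have c1 := chi_le R x
        have t1 : 1 / 2 * chi R x * r ^ 2 ≤ 1 / 2 * (2 * M ^ 2) ^ 2 := by
          have : r ^ 2 ≤ (2 * M ^ 2) ^ 2 := by rw [← sq_abs r]; gcongr
          have h5 : chi R x * r ^ 2 ≤ 1 * (2 * M ^ 2) ^ 2 :=
            mul_le_mul c1 this (sq_nonneg _) (by norm_num)
          linarith
        have t2 : |r| * |mol n (fun y => u y j) x| * |pd i (chi R) x| ≤ 2 * M ^ 2 * M * (C * R⁻¹) := by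
          have := (hC R hR x).1 i
          have := bV j hx
          gcongr
        rw [abs_of_nonneg (by positivity)]
        linarith
      unfold Psi
      calc _ ≤ ∑ i : Fin 3, ∑ j : Fin 3, K := by
            refine (Finset.abs_sum_le_sum_abs _ _).trans (Finset.sum_le_sum fun i _ => ?_)
            exact (Finset.abs_sum_le_sum_abs _ _).trans (Finset.sum_le_sum fun j _ => ht i j)
        _ = 9 * K := by simp; ring
    · rw [Set.indicator_of_notMem (by simpa using hx)]
      have h1 : chi R x = 0 := chi_far hR (not_le.1 hx).le
      have h2 := (chi_off hR (x := x) (fun h => hx h.2)).1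
      simp [Psi, h1, h2]
  · have a1 : ∀ᵐ x, ∀ j, Tendsto (fun n => mol n (fun y => u y j) x) atTop (𝓝 (u x j)) :=
      ae_all_iff.2 fun j => mol_ae (loc_ui hu_meas hu_loc j)
    have a2 : ∀ᵐ x, ∀ i j, Tendsto (fun n => mol n (fun y => u y i * u y j) x) atTop (𝓝 (u x i * u x j)) :=
      ae_all_iff.2 fun i => ae_all_iff.2 fun j => mol_ae (loc_uij hu_meas hu_loc i j)
    filter_upwards [a1, a2] with x h1 h2
    have : (0 : ℝ) = ∑ i : Fin 3, ∑ j : Fin 3, (1 / 2 * chi R x * (u x i * u x j - u x i * u x j) ^ 2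
      + |u x i * u x j - u x i * u x j| * |u x j| * |pd i (chi R) x|) := by simp
    rw [this]
    unfold Psi
    refine tendsto_finsetSum _ fun i _ => tendsto_finsetSum _ fun j _ => ?_
    have r := (h2 i j).sub ((h1 i).mul (h1 j))
    exact ((r.pow 2).const_mul _).add ((r.abs.mul (h1 j).abs).mul_const _)


lemma young3 {f t p e : ℝ} (hf : 0 ≤ f) (ht : 0 < t) (ht1 : t ≤ 1) (hp : 3 < p) (he : p ≤ e) :
    t * f ^ 3 ≤ f ^ p + t ^ (e / (e - 3)) := by
  have hc : (p / 3).HolderConjugate (p / (p - 3)) := by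
    rw [Real.holderConjugate_iff]
    refine ⟨by linarith, ?_⟩
    have : p - 3 ≠ 0 := by linarith
    field_simp
    ring
  have y := Real.young_inequality_of_nonneg (pow_nonneg hf 3) ht.le hc
  have e1 : (f ^ 3) ^ (p / 3) = f ^ p := by
    rw [← Real.rpow_natCast, ← Real.rpow_mul hf]; congr 1; push_cast; ring
  rw [e1] at y
  have h1 : f ^ p / (p / 3) ≤ f ^ p := div_le_self (Real.rpow_nonneg hf _) (by linarith)
  have h2 : t ^ (p / (p - 3)) / (p / (p - 3)) ≤ t ^ (p / (p - 3)) :=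
    div_le_self (Real.rpow_nonneg ht.le _) (by rw [le_div_iff₀ (by linarith)]; linarith)
  have h3 : t ^ (p / (p - 3)) ≤ t ^ (e / (e - 3)) := by
    refine Real.rpow_le_rpow_of_exponent_ge ht ht1 ?_
    rw [div_le_div_iff₀ (by linarith) (by linarith)]
    nlinarith
  linarith

lemma vol_annp {R : ℝ} (hR : 0 < R) :
    volume (annp R) ≤ ENNReal.ofReal ((3 * R) ^ 3) * volume (ball (0:E3) 1) := by
  have h : annp R ⊆ closedBall 0 (3 * R) := fun x hx => by simpa using hx.2
  refine (measure_mono h).trans (le_of_eq ?_)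
  rw [Measure.addHaar_closedBall _ _ (by positivity)]
  simp

lemma vol_cyl {R : ℝ} (hR : 0 < R) :
    volume (annp R ∩ cylC) ≤ ENNReal.ofReal (24 * R) := by
  let v : Fin 3 → ℝ := ![3 * R, 1, 1]
  have h : annp R ∩ cylC ⊆ (WithLp.ofLp : E3 → (Fin 3 → ℝ)) ⁻¹' (Set.Icc (-v) v) := by
    rintro x ⟨hx, hc⟩
    have hc : x 1 ^ 2 + x 2 ^ 2 ≤ 1 := hc
    have h0 := abs_le.1 ((abs_coord_le x 0).trans hx.2)
    have h1 : |x 1| ≤ 1 := by rw [← sq_le_one_iff_abs_le_one]; nlinarith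
    have h2 : |x 2| ≤ 1 := by rw [← sq_le_one_iff_abs_le_one]; nlinarith
    rw [abs_le] at h1 h2
    simp only [Set.mem_preimage, Set.mem_Icc, Pi.le_def]
    constructor
    · intro i; fin_cases i
      · simpa [v] using h0.1
      · simpa [v] using h1.1
      · simpa [v] using h2.1
    · intro i; fin_cases i
      · simpa [v] using h0.2
      · simpa [v] using h1.2
      · simpa [v] using h2.2
  refine (measure_mono h).trans (le_of_eq ?_)
  rw [(PiLp.volume_preserving_ofLp (Fin 3)).measure_preimage measurableSet_Icc.nullMeasurableSet,
    Real.volume_Icc_pi, ← ENNReal.ofReal_prod_of_nonneg]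
  · congr 1
    simp [Fin.prod_univ_three, v]; ring
  · intro i _; fin_cases i <;> simp [v] <;> linarith

lemma tail_small {g : E3 → ℝ≥0∞} (hg : Measurable g) (hgi : ∫⁻ x, g x ≠ ∞) :
    Tendsto (fun R : ℝ => ∫⁻ x in annp R, g x) atTop (𝓝 0) := by
  have h0 : ∫⁻ x : E3, (0 : ℝ≥0∞) = 0 := by simp
  rw [← h0]
  simp only [← lintegral_indicator (annp_closed _).measurableSet]
  refine tendsto_lintegral_filter_of_dominated_convergence g ?_ ?_ hgi ?_
  · exact Eventually.of_forall fun R => hg.indicator (annp_closed R).measurableSet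
  · exact Eventually.of_forall fun R => Eventually.of_forall fun x => Set.indicator_le_self _ _ _
  · refine Eventually.of_forall fun x => tendsto_const_nhds.congr' ?_
    filter_upwards [eventually_gt_atTop (2 * ‖x‖)] with R hR
    rw [Set.indicator_of_notMem]
    intro h
    linarith [h.1]

lemma cyl_meas : MeasurableSet cylC := by
  unfold cylC
  exact measurableSet_le (by fun_prop) measurable_const

lemma rpow_small {s : ℝ} (hs : 0 < s) (K : ℝ≥0∞) (hK : K ≠ ∞) :
    Tendsto (fun R : ℝ => ENNReal.ofReal (R ^ (-s)) * K) atTop (𝓝 0) := by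
  have h := ENNReal.tendsto_ofReal (tendsto_rpow_neg_atTop hs)
  have := ENNReal.Tendsto.mul_const h (Or.inr hK)
  simpa using this

lemma tail_lem {p f : E3 → ℝ} (hp : Measurable p) (hf : Measurable f) (hf0 : ∀ x, 0 ≤ f x)
    {b d : ℝ} (hb : b < 9 / 2) 
    (hout : ∀ᵐ x, x ∉ cylC → 3 < p x ∧ p x ≤ b) (hin : ∀ᵐ x, x ∈ cylC → 3 < p x ∧ p x ≤ d)
    (hb3 : 3 < b) (hd3 : 3 < d) 
    (hfin : ∫⁻ x, ENNReal.ofReal (f x ^ p x) ≠ ∞) :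
    Tendsto (fun R : ℝ => ENNReal.ofReal R⁻¹ * ∫⁻ x in annp R, ENNReal.ofReal (f x) ^ 3) atTop (𝓝 0) := by
  set β := b / (b - 3) with hβ
  set δ := d / (d - 3) with hδ
  have β3 : 3 < β := by rw [hβ, lt_div_iff₀ (by linarith)]; linarith
  have δ1 : 1 < δ := by rw [hδ, lt_div_iff₀ (by linarith)]; linarith
  have main : ∀ R : ℝ, 1 ≤ R → ENNReal.ofReal R⁻¹ * ∫⁻ x in annp R, ENNReal.ofReal (f x) ^ 3 ≤
      (∫⁻ x in annp R, ENNReal.ofReal (f x ^ p x))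
        + (ENNReal.ofReal (R ^ (-(β - 3))) * (ENNReal.ofReal 27 * volume (ball (0:E3) 1))
          + ENNReal.ofReal (R ^ (-(δ - 1))) * ENNReal.ofReal 24) := by
    intro R hR
    have R0 : 0 < R := by linarith
    have pt : ∀ᵐ x, ENNReal.ofReal R⁻¹ * ENNReal.ofReal (f x) ^ 3 ≤ ENNReal.ofReal (f x ^ p x) +
        (ENNReal.ofReal (R⁻¹ ^ β) + cylC.indicator (fun _ => ENNReal.ofReal (R⁻¹ ^ δ)) x) := by
      filter_upwards [hout, hin] with x h1 h2
      have ti : R⁻¹ ≤ 1 := inv_le_one_of_one_le₀ hR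
      rw [← ENNReal.ofReal_pow (hf0 x), ← ENNReal.ofReal_mul (by positivity)]
      by_cases hx : x ∈ cylC
      · have y := young3 (hf0 x) (t := R⁻¹) (by positivity) ti (h2 hx).1 (h2 hx).2
        rw [Set.indicator_of_mem hx]
        refine (ENNReal.ofReal_le_ofReal y).trans ?_
        rw [ENNReal.ofReal_add (Real.rpow_nonneg (hf0 x) _) (by positivity)]
        exact add_le_add le_rfl le_add_self
      · have y := young3 (hf0 x) (t := R⁻¹) (by positivity) ti (h1 hx).1 (h1 hx).2
        rw [Set.indicator_of_notMem hx, add_zero]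
        refine (ENNReal.ofReal_le_ofReal y).trans ?_
        rw [ENNReal.ofReal_add (Real.rpow_nonneg (hf0 x) _) (by positivity)]
    rw [← lintegral_const_mul _ (by fun_prop)]
    refine (lintegral_mono_ae (ae_restrict_of_ae pt)).trans ?_
    rw [lintegral_add_left (by fun_prop), lintegral_add_left (by fun_prop), setLIntegral_const,
      lintegral_indicator_const cyl_meas, Measure.restrict_apply cyl_meas]
    refine add_le_add le_rfl (add_le_add ?_ ?_)
    · refine (mul_le_mul_right (vol_annp R0) _).trans (le_of_eq ?_)
      rw [← mul_assoc, ← mul_assoc, ← ENNReal.ofReal_mul (by positivity),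
        ← ENNReal.ofReal_mul (by positivity)]
      congr 2
      rw [Real.inv_rpow R0.le, neg_sub, Real.rpow_sub R0]
      norm_cast
      field_simp
      norm_num
    · rw [Set.inter_comm]
      refine (mul_le_mul_right (vol_cyl R0) _).trans (le_of_eq ?_)
      rw [← ENNReal.ofReal_mul (by positivity), ← ENNReal.ofReal_mul (by positivity)]
      congr 1
      rw [Real.inv_rpow R0.le, neg_sub, Real.rpow_sub R0, Real.rpow_one]
      field_simp
  have l1 := tail_small (g := fun x => ENNReal.ofReal (f x ^ p x)) (by fun_prop) hfin
  have l2 := rpow_small (s := β - 3) (by linarith) (ENNReal.ofReal 27 * volume (ball (0:E3) 1))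
    (ENNReal.mul_ne_top ENNReal.ofReal_ne_top measure_ball_lt_top.ne)
  have l3 := rpow_small (s := δ - 1) (by linarith) (ENNReal.ofReal 24) ENNReal.ofReal_ne_top
  have l := l1.add (l2.add l3)
  simp only [add_zero] at l
  refine tendsto_of_tendsto_of_tendsto_of_le_of_le' tendsto_const_nhds l
    (Eventually.of_forall fun _ => zero_le) ?_
  filter_upwards [eventually_ge_atTop 1] with R hR using main R hR

lemma tail_scale {f g : E3 → ℝ} {c : ℝ} (hc : 0 ≤ c) (h : ∀ x, g x ≤ c * f x) (hf : Measurable f)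
    (ht : Tendsto (fun R : ℝ => ENNReal.ofReal R⁻¹ * ∫⁻ x in annp R, ENNReal.ofReal (f x) ^ 3) atTop (𝓝 0)) :
    Tendsto (fun R : ℝ => ENNReal.ofReal R⁻¹ * ∫⁻ x in annp R, ENNReal.ofReal (g x) ^ 3) atTop (𝓝 0) := by
  have := ENNReal.Tendsto.const_mul (a := ENNReal.ofReal c ^ 3) ht (Or.inr (by simp))
  rw [mul_zero] at this
  refine tendsto_of_tendsto_of_tendsto_of_le_of_le tendsto_const_nhds this (fun _ => zero_le) fun R => ?_
  simp only
  rw [mul_left_comm, ← lintegral_const_mul (ENNReal.ofReal c ^ 3) (by fun_prop)]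
  refine mul_le_mul_right (lintegral_mono fun x => ?_) _
  simp only
  rw [← mul_pow, ← ENNReal.ofReal_mul hc]
  gcongr
  exact h x

lemma Tail_tendsto {C : ℝ} (hC : 0 ≤ C) {u : E3 → E3} {P : E3 → ℝ}
    (h1 : ∀ j, Tendsto (fun R : ℝ => ENNReal.ofReal R⁻¹ * ∫⁻ x in annp R, ENNReal.ofReal |u x j| ^ 3) atTop (𝓝 0))
    (h2 : Tendsto (fun R : ℝ => ENNReal.ofReal R⁻¹ * ∫⁻ x in annp R, ENNReal.ofReal (√|P x|) ^ 3) atTop (𝓝 0)) :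
    Tendsto (fun R => Tail C R u P) atTop (𝓝 0) := by
  have h3 : Tendsto (fun R : ℝ => ENNReal.ofReal R⁻¹ * (ENNReal.ofReal (R⁻¹ ^ 3) * volume (annp R))) atTop (𝓝 0) := by
    have l := rpow_small (s := 1) (by norm_num) (ENNReal.ofReal 27 * volume (ball (0:E3) 1))
      (ENNReal.mul_ne_top ENNReal.ofReal_ne_top measure_ball_lt_top.ne)
    refine tendsto_of_tendsto_of_tendsto_of_le_of_le' tendsto_const_nhds l
      (Eventually.of_forall fun _ => zero_le) ?_
    filter_upwards [eventually_gt_atTop 0] with R hR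
    rw [Real.rpow_neg_one]
    refine mul_le_mul_right ((mul_le_mul_right (vol_annp hR) _).trans (le_of_eq ?_)) _
    rw [← mul_assoc, ← ENNReal.ofReal_mul (by positivity)]
    congr 2
    field_simp
    norm_num
  have hs := tendsto_finsetSum Finset.univ (fun j _ => h1 j)
  have := ENNReal.Tendsto.const_mul (a := ENNReal.ofReal (27 * C)) ((hs.add h2).add h3)
    (Or.inr ENNReal.ofReal_ne_top)
  simp only [Finset.sum_const_zero, add_zero, mul_zero] at this
  refine this.congr fun R => ?_
  rw [Tail, ENNReal.ofReal_mul (p := 27 * C) (by positivity), ← Finset.mul_sum, mul_add, mul_add, mul_add, mul_add]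
  ring


abbrev VV (u : E3 → E3) (n : ℕ) (j : Fin 3) : E3 → ℝ := mol n (fun y => u y j)

lemma VV_smooth {u : E3 → E3} (hu_meas : Measurable u)
    (hu_loc : LocallyIntegrable (fun x => ‖u x‖ ^ 2) volume) (n : ℕ) (j : Fin 3) : Smooth3 (VV u n j) :=
  mol_smooth n (loc_ui hu_meas hu_loc j)

lemma chi_mono {ρ R : ℝ} (hρ : 0 < ρ) (hR : 2 * ρ ≤ R) (x : E3) : chi ρ x ≤ chi R x := by
  by_cases h : ‖x‖ ≤ R
  · rw [chi_one (by linarith) h]; exact chi_le _ _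
  · rw [chi_far hρ (by linarith)]; exact chi_nonneg _ _

lemma grad_tendsto {u : E3 → E3} {P : E3 → ℝ} (hu_meas : Measurable u) (hPm : Measurable P)
    (hu_loc : LocallyIntegrable (fun x => ‖u x‖ ^ 2) volume) (hP : LocallyIntegrable P volume)
    (hweak : IsWeakSolutionNS u P)
    (hb : ∀ R : ℝ, ∃ M : ℝ, 0 ≤ M ∧ ∀ᵐ x, ‖x‖ < R → ‖u x‖ ≤ M)
    (hT : ∀ C : ℝ, 0 ≤ C → Tendsto (fun R => Tail C R u P) atTop (𝓝 0)) {ρ : ℝ} (hρ : 0 < ρ) :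
    Tendsto (fun n => ∫ x, chi ρ x * (∑ i, ∑ j, pd i (VV u n j) x ^ 2)) atTop (𝓝 0) := by
  obtain ⟨C, hC0, hC⟩ := chi_bounds
  have hV := VV_smooth hu_meas hu_loc
  have hS : ∀ n i j, Smooth3 (mol n (fun y => u y i * u y j)) := fun n i j =>
    mol_smooth n (loc_uij hu_meas hu_loc i j)
  have nn : ∀ n R, 0 ≤ ∫ x, chi R x * (∑ i, ∑ j, pd i (VV u n j) x ^ 2) := fun n R =>
    integral_nonneg fun x => mul_nonneg (chi_nonneg _ _)
      (Finset.sum_nonneg fun _ _ => Finset.sum_nonneg fun _ _ => sq_nonneg _)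
  rw [Metric.tendsto_atTop]
  intro ε hε
  have hε4 : (0 : ℝ≥0∞) < ENNReal.ofReal (ε / 4) := by simpa using hε
  obtain ⟨R, hR1, hR2, hR3⟩ := (((hT C hC0).eventually_lt_const hε4).and
    ((eventually_ge_atTop 2).and (eventually_ge_atTop (2 * ρ)))).exists
  have R0 : 0 < R := by linarith
  obtain ⟨M, hM, hMb⟩ := hb (2 * R + 1)
  have hPsi := Psi_tendsto R0 hu_meas hu_loc hM hMb
  obtain ⟨N, hN⟩ := eventually_atTop.1 (hPsi.eventually_lt_const (show (0:ℝ) < ε / 4 by linarith))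
  refine ⟨N, fun n hn => ?_⟩
  rw [Real.dist_0_eq_abs, abs_of_nonneg (nn n ρ)]
  have e := energy_ineq R0 hC0 (hC R R0) (hV n) (hS n) (mol_smooth n hP)
    (mol_div hu_meas hu_loc hweak n) (fun k x => mol_eq hu_meas hu_loc hP hweak n k x)
  have h1 := lt_of_le_of_lt (Phi_le n hC0 hR2 hu_meas hu_loc hPm hP) hR1
  rw [ENNReal.ofReal_lt_ofReal_iff (by linarith)] at h1
  have h2 := hN n hn
  have h3 : ∫ x, chi ρ x * (∑ i, ∑ j, pd i (VV u n j) x ^ 2) ≤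
      ∫ x, chi R x * (∑ i, ∑ j, pd i (VV u n j) x ^ 2) :=
    integral_mono (grad_int hρ (hV n)) (grad_int R0 (hV n)) fun x =>
      mul_le_mul_of_nonneg_right (chi_mono hρ hR3 x)
        (Finset.sum_nonneg fun _ _ => Finset.sum_nonneg fun _ _ => sq_nonneg _)
  change 1 / 2 * ∫ x, chi R x * (∑ i, ∑ j, pd i (VV u n j) x ^ 2) ≤ _ at e
  linarith

lemma weak_grad_zero {u : E3 → E3} (hu_meas : Measurable u)
    (hu_loc : LocallyIntegrable (fun x => ‖u x‖ ^ 2) volume)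
    (hb : ∀ R : ℝ, ∃ M : ℝ, 0 ≤ M ∧ ∀ᵐ x, ‖x‖ < R → ‖u x‖ ≤ M)
    (hG : ∀ ρ : ℝ, 0 < ρ → Tendsto (fun n => ∫ x, chi ρ x * (∑ i, ∑ j, pd i (VV u n j) x ^ 2)) atTop (𝓝 0))
    {ψ : E3 → ℝ} (hψ : Smooth3 ψ) (hc : HasCompactSupport ψ) (i j : Fin 3) :
    ∫ x, u x j * pd i ψ x = 0 := by
  have hV := VV_smooth hu_meas hu_loc
  obtain ⟨ρ, hρ, hsup⟩ : ∃ ρ : ℝ, 0 < ρ ∧ tsupport ψ ⊆ closedBall 0 ρ := by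
    obtain ⟨r, hr⟩ := hc.isCompact.isBounded.subset_closedBall (0:E3)
    exact ⟨max r 1, by positivity, hr.trans (closedBall_subset_closedBall (le_max_left _ _))⟩
  obtain ⟨M, hM, hMb⟩ := hb (ρ + 1)
  have L : Tendsto (fun n => ∫ x, VV u n j x * pd i ψ x) atTop (𝓝 (∫ x, u x j * pd i ψ x)) := by
    refine tendsto_integral_of_dominated_convergence (fun x => M * |pd i ψ x|) ?_ ?_ ?_ ?_
    · exact fun n => ((hV n j).continuous.mul (hψ.pd i).continuous).aestronglyMeasurable
    · exact (((hψ.pd i).integrable (hc.pd' i)).abs).const_mul M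
    · intro n
      refine Eventually.of_forall fun x => ?_
      by_cases hx : ‖x‖ ≤ ρ
      · rw [norm_mul]
        refine mul_le_mul_of_nonneg_right ?_ (abs_nonneg _)
        refine mol_bdd n hM ?_ hx
        filter_upwards [hMb] with y hy h
        exact (abs_coord_le _ _).trans (hy h)
      · have : pd i ψ x = 0 := (off_tsupport (fun h => hx (by simpa using hsup h))).2.1 i
        simp [this]
    · filter_upwards [mol_ae (loc_ui hu_meas hu_loc j)] with x hx
      exact hx.mul_const _
  have ibp : ∀ n, ∫ x, VV u n j x * pd i ψ x = - ∫ x, ψ x * pd i (VV u n j) x := by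
    intro n
    have z := integral_pd_eq_zero (hψ.mul (hV n j)) (hc.mul_right (f' := VV u n j)) i
    have e : ∀ x, pd i (ψ * VV u n j) x = VV u n j x * pd i ψ x + ψ x * pd i (VV u n j) x := fun x => by
      have := pd_mul hψ (hV n j) i x
      change pd i (fun y => ψ y * VV u n j y) x = _
      rw [this]; ring
    have i1 : Integrable (fun x => VV u n j x * pd i ψ x) :=
      ((hV n j).continuous.mul (hψ.pd i).continuous).integrable_of_hasCompactSupport (hc.pd' i).mul_left
    have i2 : Integrable (fun x => ψ x * pd i (VV u n j) x) :=
      (hψ.continuous.mul ((hV n j).pd i).continuous).integrable_of_hasCompactSupport hc.mul_right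
    have z2 : ∫ x, pd i (ψ * VV u n j) x = 0 := z
    simp only [e] at z2
    rw [integral_add i1 i2] at z2
    linarith
  set K := ∫ x, ψ x ^ 2 with hK
  have iψ : Integrable (fun x => ψ x ^ 2) := by
    have : Integrable (ψ * ψ) volume :=
      (hψ.continuous.mul hψ.continuous).integrable_of_hasCompactSupport (hc.mul_right (f' := ψ))
    refine this.congr (Eventually.of_forall fun x => ?_)
    simp [sq]
  have bd : ∀ t : ℝ, 0 < t → ∀ n, |∫ x, VV u n j x * pd i ψ x| ≤
      t * K + t⁻¹ * ∫ x, chi ρ x * (∑ i, ∑ j, pd i (VV u n j) x ^ 2) := by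
    intro t ht n
    rw [ibp, abs_neg, hK, ← integral_const_mul, ← integral_const_mul,
      ← integral_add (iψ.const_mul _) ((grad_int hρ (hV n)).const_mul _)]
    refine (abs_integral_le_integral_abs).trans (integral_mono_of_nonneg
      (Eventually.of_forall fun x => abs_nonneg _)
      ((iψ.const_mul _).add ((grad_int hρ (hV n)).const_mul _)) (Eventually.of_forall fun x => ?_))
    have hnn : 0 ≤ ∑ i, ∑ j, pd i (VV u n j) x ^ 2 :=
      Finset.sum_nonneg fun _ _ => Finset.sum_nonneg fun _ _ => sq_nonneg _
    have c0 := chi_nonneg ρ x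
    have ti : 0 < t⁻¹ := by positivity
    by_cases hx : ‖x‖ ≤ ρ
    · have h1 : pd i (VV u n j) x ^ 2 ≤ ∑ i, ∑ j, pd i (VV u n j) x ^ 2 :=
        (Finset.single_le_sum (f := fun j => pd i (VV u n j) x ^ 2) (fun _ _ => sq_nonneg _)
          (Finset.mem_univ j)).trans
        (Finset.single_le_sum (f := fun i => ∑ j, pd i (VV u n j) x ^ 2)
          (fun _ _ => Finset.sum_nonneg fun _ _ => sq_nonneg _) (Finset.mem_univ i))
      simp only
      rw [chi_one hρ hx, one_mul]
      have h2 := mul_le_mul_of_nonneg_left h1 ti.le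
      set a := pd i (VV u n j) x
      have h3 : |ψ x * a| ≤ t * ψ x ^ 2 + t⁻¹ * a ^ 2 := by
        have q : t * t⁻¹ = 1 := mul_inv_cancel₀ ht.ne'
        have q1 : 0 ≤ t * (ψ x - t⁻¹ * a) ^ 2 := by positivity
        have q2 : 0 ≤ t * (ψ x + t⁻¹ * a) ^ 2 := by positivity
        have e1 : t * (ψ x - t⁻¹ * a) ^ 2 = t * ψ x ^ 2 - 2 * (t * t⁻¹) * (ψ x * a) + (t * t⁻¹) * (t⁻¹ * a ^ 2) := by ring
        have e2 : t * (ψ x + t⁻¹ * a) ^ 2 = t * ψ x ^ 2 + 2 * (t * t⁻¹) * (ψ x * a) + (t * t⁻¹) * (t⁻¹ * a ^ 2) := by ring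
        rw [q] at e1 e2
        have q3 : 0 ≤ t * ψ x ^ 2 := by positivity
        have q4 : 0 ≤ t⁻¹ * a ^ 2 := by positivity
        rw [abs_le]; constructor <;> linarith
      linarith
    · have : ψ x = 0 := (off_tsupport (fun h => hx (by simpa using hsup h))).1
      simp only [this, zero_mul, abs_zero]
      positivity
  have K0 : 0 ≤ K := integral_nonneg fun x => sq_nonneg _
  have fin : ∀ t : ℝ, 0 < t → |∫ x, u x j * pd i ψ x| ≤ t * K := by
    intro t ht
    have r := ((hG ρ hρ).const_mul t⁻¹).const_add (t * K)
    have := le_of_tendsto_of_tendsto' L.abs r (bd t ht)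
    simpa using this
  by_contra hne
  have hp : 0 < |∫ x, u x j * pd i ψ x| := abs_pos.2 hne
  have := fin (|∫ x, u x j * pd i ψ x| / (2 * (K + 1))) (by positivity)
  rw [div_mul_eq_mul_div, le_div_iff₀ (by positivity)] at this
  nlinarith

lemma const_of_grad {u : E3 → E3} (hu_meas : Measurable u)
    (hu_loc : LocallyIntegrable (fun x => ‖u x‖ ^ 2) volume)
    (h : ∀ ψ : E3 → ℝ, Smooth3 ψ → HasCompactSupport ψ → ∀ i j, ∫ x, u x j * pd i ψ x = 0) :
    ∃ c : E3, ∀ᵐ x, u x = c := by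
  have hV := VV_smooth hu_meas hu_loc
  have hp : ∀ n j i x, pd i (VV u n j) x = 0 := by
    intro n j i x
    rw [pd_mol n (loc_ui hu_meas hu_loc j)]
    have := h (fun y => eta n (x - y)) (shift_smooth (eta_smooth n) x) (shift_cs (eta_cs n) x) i j
    rw [← neg_eq_zero, ← integral_neg, ← this]
    refine integral_congr_ae (Eventually.of_forall fun y => ?_)
    simp only
    rw [pd_reflect (eta_smooth n)]
    ring
  have hcst : ∀ n j x, VV u n j x = VV u n j 0 := by
    intro n j x
    refine is_const_of_fderiv_eq_zero (𝕜 := ℝ) (fun y => (hV n j).diff y) (fun y => ?_) x 0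
    have : (fderiv ℝ (VV u n j) y : E3 →ₗ[ℝ] ℝ) = 0 := by
      refine (EuclideanSpace.basisFun (Fin 3) ℝ).toBasis.ext fun i => ?_
      simpa [pd] using hp n j i y
    ext1 z
    exact LinearMap.congr_fun this z
  have a1 : ∀ᵐ x, ∀ j, Tendsto (fun n => VV u n j x) atTop (𝓝 (u x j)) :=
    ae_all_iff.2 fun j => mol_ae (loc_ui hu_meas hu_loc j)
  obtain ⟨x0, hx0⟩ := a1.exists
  refine ⟨u x0, ?_⟩
  filter_upwards [a1] with x hx
  ext j
  have h1 := hx j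
  have h2 := hx0 j
  simp only [hcst _ _ x] at h1
  simp only [hcst _ _ x0] at h2
  exact tendsto_nhds_unique h1 h2

lemma const_zero {p : E3 → ℝ} {D : ℝ} (hD : ∀ᵐ x, p x ≤ D) (hp1 : ∀ x, 1 ≤ p x) {u : E3 → E3} {c : E3}
    (hc : ∀ᵐ x, u x = c) (hu : MemVarLp p (fun x => ‖u x‖)) : c = 0 := by
  by_contra hne
  obtain ⟨l, hl, hm⟩ := hu
  have hcp : 0 < ‖c‖ := norm_pos_iff.2 hne
  set s := min (‖c‖ / l) 1 with hs
  have s0 : 0 < s := lt_min (by positivity) one_pos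
  have hlow : ∫⁻ x : E3, ENNReal.ofReal (s ^ D) ≤ 1 := by
    refine le_trans (lintegral_mono_ae ?_) hm
    filter_upwards [hD, hc] with x h1 h2
    refine ENNReal.ofReal_le_ofReal ?_
    rw [h2, abs_of_pos (by positivity)]
    calc s ^ D ≤ s ^ p x := Real.rpow_le_rpow_of_exponent_ge s0 (min_le_right _ _) h1
      _ ≤ _ := Real.rpow_le_rpow s0.le (min_le_left _ _) (by linarith [hp1 x])
  rw [lintegral_const, measure_univ_of_isAddLeftInvariant, ENNReal.mul_top] at hlow
  · simp at hlow
  · simp; positivity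


lemma ess_low {p : E3 → ℝ} {S : Set E3} (hS : MeasurableSet S) (hp1 : ∀ x, 1 ≤ p x) :
    ∀ᵐ x, x ∈ S → essInf p (volume.restrict S) ≤ p x := by
  have hb : IsBoundedUnder (· ≥ ·) (ae (volume.restrict S)) p :=
    isBoundedUnder_of ⟨1, hp1⟩
  exact (ae_restrict_iff' hS).1 (ae_essInf_le hb)

lemma ess_up {p : E3 → ℝ} {S : Set E3} (hS : MeasurableSet S)
    (hpos : 0 < essSup p (volume.restrict S)) :
    ∀ᵐ x, x ∈ S → p x ≤ essSup p (volume.restrict S) := by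
  have hb : IsBoundedUnder (· ≤ ·) (ae (volume.restrict S)) p := by
    by_contra hn
    have : essSup p (volume.restrict S) = 0 := by
      rw [essSup, limsup_eq]
      have he : {a | ∀ᶠ n in ae (volume.restrict S), p n ≤ a} = ∅ := by
        ext a
        simp only [Set.mem_setOf_eq, Set.mem_empty_iff_false, iff_false]
        intro h
        exact hn ⟨a, h⟩
      rw [he, Real.sInf_empty]
    linarith
  exact (ae_restrict_iff' hS).1 (ae_le_essSup hb)

lemma AA_init {p : E3 → ℝ} (hp : Measurable p) {u : E3 → E3} (hu : Measurable u) {a : ℝ} (ha : 3 < a)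
    (hap : ∀ᵐ x, a ≤ p x) {l : ℝ} (hl : 0 < l)
    (hfin : ∫⁻ x, ENNReal.ofReal ((‖u x‖ / l) ^ p x) ≠ ∞) : AA u (a / 2) := by
  intro R
  set K : ℝ := 2 ^ (a / 2) * (1 + l ^ a) with hK
  have K0 : 0 ≤ K := by positivity
  have pt : ∀ᵐ x, fw u x ^ (a / 2) ≤ ENNReal.ofReal K * (1 + ENNReal.ofReal ((‖u x‖ / l) ^ p x)) := by
    filter_upwards [hap] with x hx
    set f := ‖u x‖ / l with hf
    have f0 : 0 ≤ f := by positivity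
    have hv : ‖u x‖ = l * f := by rw [hf]; field_simp
    have e1 : fw u x = ENNReal.ofReal (1 + ‖u x‖ ^ 2) := by
      rw [ENNReal.ofReal_add (by norm_num) (by positivity)]; simp [fw]
    have fp : 0 ≤ f ^ p x := Real.rpow_nonneg f0 _
    rw [e1, ENNReal.ofReal_rpow_of_nonneg (by positivity) (by linarith), ← ENNReal.ofReal_one,
      ← ENNReal.ofReal_add (by norm_num) fp, ← ENNReal.ofReal_mul K0]
    refine ENNReal.ofReal_le_ofReal ?_
    have h1 : (1 + ‖u x‖ ^ 2) ^ (a / 2) ≤ 2 ^ (a / 2) * (1 + ‖u x‖ ^ a) := by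
      have e2 : (‖u x‖ ^ 2) ^ (a / 2) = ‖u x‖ ^ a := by
        rw [← Real.rpow_natCast, ← Real.rpow_mul (norm_nonneg _)]; congr 1; push_cast; ring
      rcases le_total (‖u x‖ ^ 2) 1 with h | h
      · calc (1 + ‖u x‖ ^ 2) ^ (a / 2) ≤ 2 ^ (a / 2) :=
              Real.rpow_le_rpow (by positivity) (by linarith) (by linarith)
          _ ≤ _ := le_mul_of_one_le_right (by positivity) (by
              have : 0 ≤ ‖u x‖ ^ a := by positivity
              linarith)
      · calc (1 + ‖u x‖ ^ 2) ^ (a / 2) ≤ (2 * ‖u x‖ ^ 2) ^ (a / 2) :=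
              Real.rpow_le_rpow (by positivity) (by linarith) (by linarith)
          _ = 2 ^ (a / 2) * ‖u x‖ ^ a := by
              rw [Real.mul_rpow (by norm_num) (by positivity), e2]
          _ ≤ _ := mul_le_mul_of_nonneg_left (by linarith) (by positivity)
    refine h1.trans ?_
    rw [hK, mul_assoc]
    refine mul_le_mul_of_nonneg_left ?_ (by positivity)
    have h2 : f ^ a ≤ 1 + f ^ p x := by
      rcases le_total f 1 with h | h
      · have := Real.rpow_le_one f0 h (by linarith : 0 ≤ a)
        linarith
      · have := Real.rpow_le_rpow_of_exponent_le h hx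
        linarith
    rw [hv, Real.mul_rpow hl.le f0]
    have la : 0 ≤ l ^ a := by positivity
    nlinarith
  refine lt_of_le_of_lt (lintegral_mono_ae (ae_restrict_of_ae pt)) ?_
  rw [lintegral_const_mul _ (by fun_prop), lintegral_add_left (by fun_prop), setLIntegral_const, one_mul]
  refine ENNReal.mul_lt_top ENNReal.ofReal_lt_top (ENNReal.add_lt_top.2 ⟨measure_ball_lt_top, ?_⟩)
  exact lt_of_le_of_lt (setLIntegral_le_lintegral _ _) (lt_top_iff_ne_top.2 hfin)

/-- **Theorem 1.** Liouville theorem for the stationary Navier–Stokes equations with a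
variable exponent adapted to the cylinder `𝒞`. -/
theorem liouville_NS_cylinder
    (p : E3 → ℝ) (hpmeas : Measurable p) (hp1 : ∀ x, 1 ≤ p x)
    (hout_lb : (3 : ℝ) < essInf p (volume.restrict cylCᶜ))
    (hout_le : essInf p (volume.restrict cylCᶜ) ≤ essSup p (volume.restrict cylCᶜ))
    (hout_ub : essSup p (volume.restrict cylCᶜ) < 9 / 2)
    (hin_lb : (9 / 2 : ℝ) < essInf p (volume.restrict cylC))
    (hin_le : essInf p (volume.restrict cylC) ≤ essSup p (volume.restrict cylC))
    (hin_ub : IsBoundedUnder (· ≤ ·) (ae (volume.restrict cylC)) p)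
    (u : E3 → E3) (P : E3 → ℝ)
    (hu_meas : Measurable u) (hP_meas : Measurable P)
    (hu_loc : LocallyIntegrable (fun x => ‖u x‖ ^ 2) volume)
    (hP_loc : LocallyIntegrable P volume)
    (hweak : IsWeakSolutionNS u P)
    (hu_p : MemVarLp p (fun x => ‖u x‖))
    (hP_p : MemVarLp (fun x => p x / 2) P) :
    ∀ᵐ x : E3, u x = 0 := by
  set a := essInf p (volume.restrict cylCᶜ) with ha
  set b := essSup p (volume.restrict cylCᶜ) with hb
  have o1 := ess_low cyl_meas.compl hp1
  have o2 := ess_up (p := p) cyl_meas.compl (by linarith)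
  have n1 := ess_low cyl_meas hp1
  have n2 := ess_up (p := p) cyl_meas (by linarith)
  set d := essSup p (volume.restrict cylC) with hd
  rw [← ha] at o1
  rw [← hb] at o2
  have hout : ∀ᵐ x, x ∉ cylC → 3 < p x ∧ p x ≤ b := by
    filter_upwards [o1, o2] with x h1 h2 hx
    exact ⟨lt_of_lt_of_le hout_lb (h1 hx), h2 hx⟩
  have hin : ∀ᵐ x, x ∈ cylC → 3 < p x ∧ p x ≤ d := by
    filter_upwards [n1, n2] with x h1 h2 hx
    exact ⟨by linarith [h1 hx], h2 hx⟩
  have hap : ∀ᵐ x, a ≤ p x := by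
    filter_upwards [o1, n1] with x h1 h2
    by_cases hx : x ∈ cylC
    · linarith [h2 hx]
    · exact h1 hx
  have hpd : ∀ᵐ x, p x ≤ d := by
    filter_upwards [hout, hin] with x h1 h2
    by_cases hx : x ∈ cylC
    · exact (h2 hx).2
    · linarith [(h1 hx).2]
  obtain ⟨l, hl, hml⟩ := id hu_p
  obtain ⟨l2, hl2, hml2⟩ := hP_p
  have fin1 : ∫⁻ x, ENNReal.ofReal ((‖u x‖ / l) ^ p x) ≠ ∞ := by
    have e : modularV p (fun x => ‖u x‖ / l) = ∫⁻ x, ENNReal.ofReal ((‖u x‖ / l) ^ p x) := by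
      unfold modularV
      refine lintegral_congr fun x => ?_
      rw [abs_of_nonneg (by positivity)]
    rw [← e]
    exact ne_top_of_le_ne_top ENNReal.one_ne_top hml
  have fin2 : ∫⁻ x, ENNReal.ofReal ((√|P x| / √l2) ^ p x) ≠ ∞ := by
    have e : modularV (fun x => p x / 2) (fun x => P x / l2) =
        ∫⁻ x, ENNReal.ofReal ((√|P x| / √l2) ^ p x) := by
      unfold modularV
      refine lintegral_congr fun x => ?_
      rw [abs_div, abs_of_pos hl2, ← Real.sqrt_div (abs_nonneg _), Real.sqrt_eq_rpow,
        ← Real.rpow_mul (by positivity)]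
      congr 2; ring
    rw [← e]
    exact ne_top_of_le_ne_top ENNReal.one_ne_top hml2
  have hAA := AA_init hpmeas hu_meas hout_lb hap hl fin1
  have hbd := u_bdd hu_meas hu_loc hweak (by linarith) hAA
  have t1 := tail_lem (f := fun x => ‖u x‖ / l) hpmeas (by fun_prop) (fun x => by positivity)
    hout_ub hout hin (by linarith) (by linarith) fin1
  have t2 := tail_lem (f := fun x => √|P x| / √l2) hpmeas (by fun_prop) (fun x => by positivity)
    hout_ub hout hin (by linarith) (by linarith) fin2
  have hT : ∀ C : ℝ, 0 ≤ C → Tendsto (fun R => Tail C R u P) atTop (𝓝 0) := by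
    intro C hC
    refine Tail_tendsto hC (fun j => ?_) ?_
    · refine tail_scale hl.le (fun x => ?_) (by fun_prop) t1
      refine (abs_coord_le _ _).trans (le_of_eq ?_)
      field_simp
    · refine tail_scale (Real.sqrt_nonneg l2) (fun x => ?_) (by fun_prop) t2
      have : √l2 ≠ 0 := (Real.sqrt_pos.2 hl2).ne'
      refine le_of_eq ?_
      field_simp
  have hG := fun ρ (hρ : (0:ℝ) < ρ) =>
    grad_tendsto hu_meas hP_meas hu_loc hP_loc hweak hbd hT hρ
  obtain ⟨c, hc⟩ := const_of_grad hu_meas hu_loc fun ψ hψ hcs i j =>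
    weak_grad_zero hu_meas hu_loc hbd hG hψ hcs i j
  have c0 := const_zero hpd hp1 hc hu_p
  rw [c0] at hc
  exact hc
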